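/- arXiv:1506.08169 — 2 statements merged into one kernel-verified Lean document; each statement's English description precedes it below -/
import Mathlib

section
/- Let p be a prime and let G be a finite p-solvable group of odd order. Then the number of conjugacy classes of G consisting of p-elements equals the number of Q_p-valued irreducible characters of G. -/
open scoped Classical

noncomputable section

/-- `Qfield p` is the subfield of `ℂ` obtained by adjoining to `ℚ` all `p^a`-th
roots of unity for all positive integers `a` (any subfield of `ℂ` contains `ℚ`). -/
def Qfield (p : ℕ) : Subfield ℂ :=
  Subfield.closure {x : ℂ | ∃ a : ℕ, 0 < a ∧ x ^ p ^ a = 1}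

/-- `χ : G → ℂ` is an irreducible (ordinary, complex) character of `G` if it is the
character of some simple finite-dimensional complex representation of `G`. -/
def IsIrreducibleCharacter (G : Type) [Group G] (χ : G → ℂ) : Prop :=
  ∃ V : FDRep ℂ G, CategoryTheory.Simple V ∧ χ = fun g => V.character g

/-- The set of `Q_p`-valued irreducible characters of `G`. -/
def QpValuedIrrChars (p : ℕ) (G : Type) [Group G] : Set (G → ℂ) :=
  {χ | IsIrreducibleCharacter G χ ∧ ∀ g, χ g ∈ Qfield p}

/-- The set of conjugacy classes of `G` consisting of `p`-elements, i.e. elements of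
`p`-power order (the identity is included). -/
def PElementClasses (p : ℕ) (G : Type) [Group G] : Set (ConjClasses G) :=
  {c | ∃ g : G, c = ConjClasses.mk g ∧ ∃ k : ℕ, orderOf g = p ^ k}

/-- A group `G` is `p`-solvable if it has a subnormal series in which every factor is
either a `p`-group or a group of order coprime to `p` (factors are expressed via the
cardinality of the corresponding coset spaces). -/
def IsPSolvable (p : ℕ) (G : Type) [Group G] : Prop :=
  ∃ (n : ℕ) (H : ℕ → Subgroup G),
    H 0 = ⊥ ∧ H n = ⊤ ∧
    (∀ i, i < n → H i ≤ H (i + 1)) ∧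
    (∀ i, i < n → ((H i).subgroupOf (H (i + 1))).Normal) ∧
    (∀ i, i < n →
      (∃ k : ℕ, Nat.card ((H (i + 1) : Subgroup G) ⧸ (H i).subgroupOf (H (i + 1))) = p ^ k) ∨
      Nat.Coprime (Nat.card ((H (i + 1) : Subgroup G) ⧸ (H i).subgroupOf (H (i + 1)))) p)

theorem exists_ringEquiv_extending (K L : Type*) [Field K] [Field L] [IsAlgClosed L] [Algebra K L]
    (e : K ≃+* K) : ∃ τ : L ≃+* L, ∀ x, τ (algebraMap K L x) = algebraMap K L (e x) := by
  obtain ⟨s, hs⟩ := exists_isTranscendenceBasis K L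
  let := IsAlgClosed.isAlgClosure_of_transcendence_basis _ hs
  let e' : Algebra.adjoin K (Set.range ((↑) : s → L)) ≃+*
      Algebra.adjoin K (Set.range ((↑) : s → L)) :=
    hs.1.aevalEquiv.symm.toRingEquiv.trans
      ((MvPolynomial.mapEquiv s e).trans hs.1.aevalEquiv.toRingEquiv)
  refine ⟨IsAlgClosure.equivOfEquiv L L e', fun x => ?_⟩
  have := IsAlgClosure.equivOfEquiv_algebraMap L L e' (algebraMap K _ x)
  rw [← IsScalarTower.algebraMap_apply] at this
  rw [this]
  have h1 : e' (algebraMap K _ x) = algebraMap K _ (e x) := by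
    simp only [e', RingEquiv.trans_apply]
    have : hs.1.aevalEquiv.symm.toRingEquiv (algebraMap K _ x) = MvPolynomial.C x :=
      hs.1.aevalEquiv.symm.commutes x
    rw [this]
    simp only [MvPolynomial.mapEquiv_apply, MvPolynomial.map_C]
    exact hs.1.aevalEquiv.commutes (e x)
  rw [h1, ← IsScalarTower.algebraMap_apply]

theorem exists_ringEquiv_pow_of_coprime {N k : ℕ} (hN : N ≠ 0) (hk : k.Coprime N) :
    ∃ τ : ℂ ≃+* ℂ, ∀ z : ℂ, z ^ N = 1 → τ z = z ^ k := by
  have _ : NeZero N := ⟨hN⟩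
  let K := CyclotomicField N ℚ
  have : IsCyclotomicExtension {N} ℚ K := CyclotomicField.isCyclotomicExtension N ℚ
  let : Algebra K ℂ := (IsAlgClosed.lift (R := ℚ) (S := K) (M := ℂ)).toRingHom.toAlgebra
  have hζ := IsCyclotomicExtension.zeta_spec N ℚ K
  have hirr := Polynomial.cyclotomic.irreducible_rat (Nat.pos_of_ne_zero hN)
  have hζ' : IsPrimitiveRoot (algebraMap K ℂ (IsCyclotomicExtension.zeta N ℚ K)) N :=
    hζ.map_of_injective (algebraMap K ℂ).injective
  let e := IsCyclotomicExtension.fromZetaAut (hζ.pow_of_coprime k hk) hirr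
  have he := IsCyclotomicExtension.fromZetaAut_spec (hζ.pow_of_coprime k hk) hirr
  obtain ⟨τ, hτ⟩ := exists_ringEquiv_extending K ℂ e.toRingEquiv
  refine ⟨τ, fun z hz => ?_⟩
  obtain ⟨i, -, rfl⟩ := hζ'.eq_pow_of_pow_eq_one hz
  rw [map_pow, hτ, ← pow_mul, mul_comm i k, pow_mul, ← map_pow (algebraMap K ℂ) _ k]
  exact congrArg (fun y => algebraMap K ℂ y ^ i) he

theorem mem_of_forall_ringEquiv_fixed (F : Subfield ℂ) {x : ℂ} (hx : IsIntegral ℤ x)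
    (h : ∀ τ : ℂ ≃+* ℂ, (∀ y ∈ F, τ y = y) → τ x = x) : x ∈ F := by
  let A := algebraicClosure F ℂ
  have hxA : x ∈ A := by
    have : IsIntegral F x := hx.tower_top
    exact mem_algebraicClosure_iff.2 this.isAlgebraic
  have : IsGalois F A := {}
  have := (InfiniteGalois.mem_range_algebraMap_iff_fixed (k := F) (K := A) ⟨x, hxA⟩).2 ?_
  · obtain ⟨y, hy⟩ := this
    have : (y : ℂ) = x := congrArg (algebraMap A ℂ) hy
    exact this ▸ y.2
  · intro f
    obtain ⟨τ, hτ⟩ := exists_ringEquiv_extending A ℂ f.toRingEquiv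
    have h1 := hτ ⟨x, hxA⟩
    rw [show algebraMap A ℂ ⟨x, hxA⟩ = x from rfl, h τ ?_] at h1
    · exact Subtype.ext h1.symm
    · intro y hy
      have h2 := hτ (algebraMap F A ⟨y, hy⟩)
      have h3 : f.toRingEquiv (algebraMap F A ⟨y, hy⟩) = algebraMap F A ⟨y, hy⟩ := f.commutes _
      rw [h3] at h2
      exact h2

theorem trace_pow_eq_sum_of_pow_eq_one {V : Type*} [AddCommGroup V] [Module ℂ V]
    [FiniteDimensional ℂ V] (f : Module.End ℂ V) {n : ℕ} (hn : n ≠ 0) (hf : f ^ n = 1) :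
    ∃ s : Multiset ℂ, (∀ z ∈ s, z ^ n = 1) ∧
      ∀ k : ℕ, LinearMap.trace ℂ V (f ^ k) = (s.map (· ^ k)).sum := by
  have hss : f.IsSemisimple := by
    refine Module.End.isSemisimple_of_squarefree_aeval_eq_zero (p := Polynomial.X ^ n - 1) ?_ ?_
    · exact (Polynomial.separable_X_pow_sub_C (1 : ℂ) (by exact_mod_cast hn) one_ne_zero).squarefree
    · simp [hf]
  have hinternal : DirectSum.IsInternal f.eigenspace :=
    (DirectSum.isInternal_submodule_iff_iSupIndep_and_iSup_eq_top _).2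
      ⟨f.eigenspaces_iSupIndep, hss.iSup_eigenspace_eq_top⟩
  have hfin : {μ | f.eigenspace μ ≠ ⊥}.Finite :=
    WellFoundedGT.finite_ne_bot_of_iSupIndep hinternal.submodule_iSupIndep
  have hpow : ∀ (k : ℕ) (μ : ℂ) (v : V), v ∈ f.eigenspace μ → (f ^ k) v = μ ^ k • v := by
    intro k μ v hv
    induction k with
    | zero => simp
    | succ k ih =>
      rw [pow_succ', Module.End.mul_apply, ih, map_smul, Module.End.mem_eigenspace_iff.1 hv,
        smul_smul, pow_succ]
  refine ⟨∑ μ ∈ hfin.toFinset, Multiset.replicate (Module.finrank ℂ (f.eigenspace μ)) μ, ?_, ?_⟩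
  · intro z hz
    obtain ⟨μ, hμ, hz⟩ := Multiset.mem_sum.1 hz
    obtain rfl := Multiset.eq_of_mem_replicate hz
    obtain ⟨v, hv, hv0⟩ := (Submodule.ne_bot_iff _).1 (hfin.mem_toFinset.1 hμ)
    have := hpow n z v hv
    rw [hf, Module.End.one_apply] at this
    exact (smul_left_injective ℂ hv0 (by simpa using this)).symm
  · intro k
    have hm : ∀ μ, Set.MapsTo (f ^ k) (f.eigenspace μ) (f.eigenspace μ) := fun μ v hv => by
      rw [SetLike.mem_coe, hpow k μ v hv]
      exact Submodule.smul_mem _ _ hv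
    rw [LinearMap.trace_eq_sum_trace_restrict' hinternal hfin hm,
      ← Multiset.coe_mapAddMonoidHom, map_sum, ← Multiset.coe_sumAddMonoidHom, map_sum]
    refine Finset.sum_congr rfl fun μ _ => ?_
    have : (f ^ k).restrict (hm μ) = μ ^ k • LinearMap.id := by
      ext v
      exact hpow k μ v v.2
    rw [this]
    simp [mul_comm]

theorem FDRep.simple_of_isIrreducible {G : Type} [Group G] [Finite G] {V : Type} [AddCommGroup V]
    [Module ℂ V] [FiniteDimensional ℂ V] (ρ : Representation ℂ G V) [ρ.IsIrreducible] :
    CategoryTheory.Simple (FDRep.of ρ) := by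
  have := Fintype.ofFinite G
  have := invertibleOfNonzero (NeZero.ne (Nat.card G : ℂ))
  rw [FDRep.simple_iff_char_is_norm_one]
  have h := Representation.card_inv_mul_sum_char_mul_char_eq_finrank ρ ρ
  rw [Representation.IsIrreducible.finrank_intertwiningMap_self, Nat.cast_one,
    inv_mul_eq_one₀ (NeZero.ne _)] at h
  exact h.symm

theorem sum_smul_eq_zero_of_orthogonal {G : Type} [Group G] [Fintype G] (f : G → ℂ)
    (hf : ∀ g h, f (h * g * h⁻¹) = f g)
    (horth : ∀ V : FDRep ℂ G, CategoryTheory.Simple V → ∑ g, f g * V.character g⁻¹ = 0)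
    (n : ℕ) : ∀ (V : Type) [AddCommGroup V] [Module ℂ V] [FiniteDimensional ℂ V]
      (ρ : Representation ℂ G V), Module.finrank ℂ V = n → ∑ g, f g • ρ g⁻¹ = 0 := by
  induction n using Nat.strong_induction_on with
  | _ n ih =>
    intro V _ _ _ ρ hn
    by_cases hirr : ρ.IsIrreducible
    · let T : Representation.IntertwiningMap ρ ρ :=
        ⟨∑ g, f g • ρ g⁻¹, fun h => by
          ext v
          simp only [LinearMap.comp_apply, LinearMap.sum_apply, LinearMap.smul_apply, map_sum,
            map_smul]
          refine Fintype.sum_equiv (MulAut.conj h⁻¹).toEquiv _ _ fun g => ?_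
          have h1 : (MulAut.conj h⁻¹).toEquiv g = h⁻¹ * g * h⁻¹⁻¹ := rfl
          rw [h1, hf, ← Module.End.mul_apply, ← Module.End.mul_apply, ← map_mul, ← map_mul]
          congr 3
          group⟩
      obtain ⟨c, hc⟩ :=
        (Representation.IsIrreducible.algebraMap_intertwiningMap_bijective_of_isAlgClosed
          (k := ℂ) (ρ := ρ)).2 T
      have hT : ∑ g, f g • ρ g⁻¹ = c • LinearMap.id := by
        have := congrArg Representation.IntertwiningMap.toLinearMap hc.symm
        exact this
      have htr := congrArg (LinearMap.trace ℂ V) hT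
      have h0 : LinearMap.trace ℂ V (∑ g, f g • ρ g⁻¹) = 0 := by
        rw [map_sum]
        simp only [map_smul, smul_eq_mul]
        exact horth _ (FDRep.simple_of_isIrreducible ρ)
      have : Nontrivial V := by
        by_contra hV
        rw [not_nontrivial_iff_subsingleton] at hV
        have : (⊥ : Subrepresentation ρ) ≠ ⊤ := bot_ne_top
        exact this (Subrepresentation.toSubmodule_injective (Subsingleton.elim _ _))
      rw [h0, map_smul, LinearMap.trace_id, smul_eq_mul, eq_comm, mul_eq_zero] at htr
      rw [hT, htr.resolve_right (by exact_mod_cast Module.finrank_pos.ne'), zero_smul]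
    · by_cases hV : Subsingleton V
      · exact LinearMap.ext fun v => Subsingleton.elim _ _
      · rw [not_subsingleton_iff_nontrivial] at hV
        have hnt : Nontrivial (Subrepresentation ρ) :=
          ⟨⊥, ⊤, fun h => bot_ne_top (congrArg Subrepresentation.toSubmodule h)⟩
        obtain ⟨W, hW⟩ : ∃ W : Subrepresentation ρ, W ≠ ⊥ ∧ W ≠ ⊤ := by
          by_contra! h
          exact hirr ⟨fun W => or_iff_not_imp_left.2 (h W)⟩
        obtain ⟨W', hWW'⟩ := exists_isCompl W
        have key : ∀ U : Subrepresentation ρ, U ≠ ⊤ → ∀ u ∈ U.toSubmodule,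
            (∑ g, f g • ρ g⁻¹) u = 0 := by
          intro U hU u hu
          have hlt : Module.finrank ℂ U.toSubmodule < n := by
            rw [← hn]
            exact Submodule.finrank_lt fun h => hU (Subrepresentation.toSubmodule_injective h)
          have := LinearMap.congr_fun (ih _ hlt U.toSubmodule U.toRepresentation rfl) ⟨u, hu⟩
          have h2 := congrArg (Submodule.subtype _) this
          simpa [LinearMap.sum_apply, Subrepresentation.toRepresentation] using h2
        have hW' : W' ≠ ⊤ := by
          rintro rfl
          exact hW.1 (by simpa using hWW'.inf_eq_bot)
        ext v
        have hv : v ∈ W.toSubmodule ⊔ W'.toSubmodule := by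
          rw [← Subrepresentation.toSubmodule_sup, hWW'.sup_eq_top]
          exact Submodule.mem_top
        obtain ⟨a, ha, b, hb, rfl⟩ := Submodule.mem_sup.1 hv
        rw [map_add, key W hW.2 a ha, key W' hW' b hb]
        simp

theorem eq_zero_of_forall_irreducible_orthogonal {G : Type} [Group G] [Fintype G] (f : G → ℂ)
    (hf : ∀ g h, f (h * g * h⁻¹) = f g)
    (horth : ∀ V : FDRep ℂ G, CategoryTheory.Simple V → ∑ g, f g * V.character g⁻¹ = 0) :
    f = 0 := by
  have h := sum_smul_eq_zero_of_orthogonal f hf horth _ _ (Representation.leftRegular ℂ G) rfl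
  have h1 := LinearMap.congr_fun h (MonoidAlgebra.single 1 1)
  funext x
  have h2 := congrArg (fun a : MonoidAlgebra ℂ G => a.coeff x⁻¹) h1
  simpa [LinearMap.sum_apply, Finsupp.finsetSum_apply, Finsupp.single_apply] using h2

namespace IsIrreducibleCharacter

variable {G : Type} [Group G] {χ ψ : G → ℂ}

theorem conj_apply (hχ : IsIrreducibleCharacter G χ) (g h : G) : χ (h * g * h⁻¹) = χ g := by
  obtain ⟨V, -, rfl⟩ := hχ
  exact V.char_conj g h

theorem exists_multiset_pow (hχ : IsIrreducibleCharacter G χ) {g : G} {n : ℕ} (hn : n ≠ 0)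
    (hg : g ^ n = 1) : ∃ s : Multiset ℂ, (∀ z ∈ s, z ^ n = 1) ∧
      ∀ k : ℕ, χ (g ^ k) = (s.map (· ^ k)).sum := by
  obtain ⟨V, -, rfl⟩ := hχ
  obtain ⟨s, hs, h⟩ := trace_pow_eq_sum_of_pow_eq_one (V.ρ g) hn (by rw [← map_pow, hg, map_one])
  exact ⟨s, hs, fun k => by rw [← h k, ← map_pow]; rfl⟩

theorem isIntegral [Finite G] (hχ : IsIrreducibleCharacter G χ) (g : G) : IsIntegral ℤ (χ g) := by
  obtain ⟨s, hs, h⟩ := hχ.exists_multiset_pow Nat.card_pos.ne' (pow_card_eq_one' (x := g))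
  have := h 1
  rw [pow_one] at this
  rw [this]
  refine IsIntegral.multiset_sum fun z hz => ?_
  obtain ⟨w, hw, rfl⟩ := Multiset.mem_map.1 hz
  rw [pow_one]
  refine IsIntegral.of_pow (Nat.card_pos (α := G)) ?_
  rw [hs w hw]
  exact isIntegral_one

theorem ringEquiv_apply_eq_apply_pow (hχ : IsIrreducibleCharacter G χ) {g : G} {n k : ℕ}
    (hn : n ≠ 0) (hg : g ^ n = 1) (τ : ℂ ≃+* ℂ) (hτ : ∀ z : ℂ, z ^ n = 1 → τ z = z ^ k) :
    τ (χ g) = χ (g ^ k) := by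
  obtain ⟨s, hs, h⟩ := hχ.exists_multiset_pow hn hg
  have := h 1
  rw [pow_one] at this
  rw [this, h k, map_multiset_sum, Multiset.map_map]
  exact congrArg _ (Multiset.map_congr rfl fun z hz => by simp [hτ z (hs z hz)])

theorem sum_mul_inv [Fintype G] (hχ : IsIrreducibleCharacter G χ)
    (hψ : IsIrreducibleCharacter G ψ) :
    ∑ g, χ g * ψ g⁻¹ = if χ = ψ then (Fintype.card G : ℂ) else 0 := by
  obtain ⟨V, hV, rfl⟩ := hχ
  obtain ⟨W, hW, rfl⟩ := hψ
  have := invertibleOfNonzero (NeZero.ne (Nat.card G : ℂ))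
  split_ifs with h
  · have := (FDRep.simple_iff_char_is_norm_one V).1 hV
    rw [← Nat.card_eq_fintype_card, ← this]
    exact Finset.sum_congr rfl fun g _ => congrArg _ (congrFun h g⁻¹).symm
  · have h1 := FDRep.char_orthonormal V W
    rw [if_neg, mul_eq_zero, inv_eq_zero] at h1
    · exact h1.resolve_left (NeZero.ne _)
    · rintro ⟨i⟩
      exact h (FDRep.char_iso i)

theorem ringEquiv_comp [Finite G] (hχ : IsIrreducibleCharacter G χ) (τ : ℂ ≃+* ℂ) :
    IsIrreducibleCharacter G (fun g => τ (χ g)) := by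
  have := Fintype.ofFinite G
  obtain ⟨V, hV, rfl⟩ := hχ
  let b := Module.finBasis ℂ V
  let ρ : Representation ℂ G (Fin (Module.finrank ℂ V) → ℂ) :=
    (Matrix.toLinAlgEquiv' (R := ℂ)).toAlgHom.toRingHom.toMonoidHom.comp
      ((τ : ℂ →+* ℂ).mapMatrix.toMonoidHom.comp
        ((LinearMap.toMatrixAlgEquiv b).toAlgHom.toRingHom.toMonoidHom.comp V.ρ))
  have hρ : ∀ g, (FDRep.of ρ).character g = τ (V.character g) := by
    intro g
    have h1 : (FDRep.of ρ).character g = LinearMap.trace ℂ _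
      (Matrix.toLin' ((τ : ℂ →+* ℂ).mapMatrix (LinearMap.toMatrix b b (V.ρ g)))) := rfl
    rw [h1, Matrix.trace_toLin'_eq, FDRep.character, LinearMap.trace_eq_matrix_trace ℂ b]
    simp [Matrix.trace]
  refine ⟨FDRep.of ρ, ?_, funext fun g => (hρ g).symm⟩
  rw [FDRep.simple_iff_char_is_norm_one] at hV ⊢
  simp only [hρ, ← map_mul]
  rw [← map_sum, hV, map_natCast]

end IsIrreducibleCharacter

theorem linearIndependent_irreducibleCharacters (G : Type) [Group G] [Finite G] :
    LinearIndependent ℂ (fun χ : {χ // IsIrreducibleCharacter G χ} => χ.1) := by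
  have := Fintype.ofFinite G
  rw [linearIndependent_iff']
  intro s c hc ψ hψ
  have h := congrArg (fun f : G → ℂ => ∑ g, f g * ψ.1 g⁻¹) hc
  simp only [Finset.sum_apply, Pi.smul_apply, smul_eq_mul, Pi.zero_apply, zero_mul,
    Finset.sum_const_zero, Finset.sum_mul] at h
  rw [Finset.sum_comm] at h
  simp only [mul_assoc, ← Finset.mul_sum] at h
  simp only [fun χ : {χ // IsIrreducibleCharacter G χ} => χ.2.sum_mul_inv ψ.2,
    ← Subtype.ext_iff] at h
  simpa [hψ] using h

theorem finite_irreducibleCharacters (G : Type) [Group G] [Finite G] :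
    Finite {χ // IsIrreducibleCharacter G χ} :=
  (linearIndependent_irreducibleCharacters G).finite

theorem sum_irreducibleCharacters_mul_sum_conj {G : Type} [Group G] [Fintype G]
    [Fintype {χ // IsIrreducibleCharacter G χ}] (x : G) (c : ConjClasses G) :
    ∑ χ : {χ // IsIrreducibleCharacter G χ}, χ.1 x * ∑ g with ConjClasses.mk g = c, χ.1 g⁻¹ =
      if ConjClasses.mk x = c then (Fintype.card G : ℂ) else 0 := by
  let f : G → ℂ := fun x => (if ConjClasses.mk x = c then (Fintype.card G : ℂ) else 0) -
    ∑ χ : {χ // IsIrreducibleCharacter G χ}, χ.1 x * ∑ g with ConjClasses.mk g = c, χ.1 g⁻¹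
  have hmk : ∀ g h : G, ConjClasses.mk (h * g * h⁻¹) = ConjClasses.mk g := fun g h =>
    ConjClasses.mk_eq_mk_iff_isConj.2 (isConj_iff.2 ⟨h⁻¹, by group⟩)
  have hf : f = 0 := by
    refine eq_zero_of_forall_irreducible_orthogonal f (fun g h => ?_) fun V hV => ?_
    · simp only [f, hmk, fun χ : {χ // IsIrreducibleCharacter G χ} => χ.2.conj_apply]
    · let ψ : {χ // IsIrreducibleCharacter G χ} := ⟨fun g => V.character g, V, hV, rfl⟩
      change ∑ g, f g * ψ.1 g⁻¹ = 0
      simp only [f, sub_mul, Finset.sum_sub_distrib, Finset.sum_mul]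
      rw [Finset.sum_comm (s := Finset.univ) (t := Finset.univ), sub_eq_zero]
      have h1 : ∀ χ : {χ // IsIrreducibleCharacter G χ},
          ∑ g, χ.1 g * (∑ g with ConjClasses.mk g = c, χ.1 g⁻¹) * ψ.1 g⁻¹ =
          if χ = ψ then (Fintype.card G : ℂ) * ∑ g with ConjClasses.mk g = c, χ.1 g⁻¹ else 0 := by
        intro χ
        simp only [mul_right_comm _ _ (ψ.1 _)]
        rw [← Finset.sum_mul, χ.2.sum_mul_inv ψ.2, ite_mul, zero_mul]
        simp only [← Subtype.ext_iff]
      simp only [h1]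
      simp [Finset.sum_filter, Finset.mul_sum]
  exact (sub_eq_zero.1 (congrFun hf x)).symm

theorem sum_eq_sum_fixedPoints_of_two_eq_zero {α R : Type*} [Fintype α] [CommRing R]
    (h2 : (2 : R) = 0) (s : α → α) (hs : Function.Involutive s) (F : α → R)
    (hF : ∀ x, F (s x) = F x) : ∑ x, F x = ∑ x with s x = x, F x := by
  rw [← Finset.sum_filter_add_sum_filter_not Finset.univ (fun x => s x = x), add_eq_left]
  refine Finset.sum_involution (fun x _ => s x) (fun x _ => ?_) (fun x hx _ => ?_)
    (fun x hx => ?_) (fun x _ => hs x)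
  · rw [hF, ← two_mul, h2, zero_mul]
  · exact (Finset.mem_filter.1 hx).2
  · simp only [Finset.mem_filter, Finset.mem_univ, true_and] at hx ⊢
    rw [hs x]
    exact fun h => hx h.symm

theorem exists_reduction_mod_two : ∃ (R : Type) (_ : CommRing R) (_ : Nontrivial R),
    (2 : R) = 0 ∧ Nonempty (integralClosure ℤ ℂ →+* R) := by
  have hI : Ideal.span {(2 : integralClosure ℤ ℂ)} ≠ ⊤ := by
    intro h
    obtain ⟨y, hy⟩ := Ideal.mem_span_singleton'.1 ((Ideal.eq_top_iff_one _).1 h)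
    have hy' : (y : ℂ) * 2 = 1 := congrArg Subtype.val hy
    have h1 : (y : ℂ) = algebraMap ℚ ℂ (1 / 2) := by
      rw [eq_div_of_mul_eq two_ne_zero hy']
      simp
    have h2 : IsIntegral ℤ (algebraMap ℚ ℂ (1 / 2)) := h1 ▸ y.2
    rw [isIntegral_algebraMap_iff (algebraMap ℚ ℂ).injective,
      IsIntegrallyClosed.isIntegral_iff] at h2
    obtain ⟨z, hz⟩ := h2
    have h3 : (z : ℚ) * 2 = 1 := by
      rw [show (z : ℚ) = 1 / 2 from hz]
      norm_num
    have h4 : z * 2 = 1 := by exact_mod_cast h3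
    omega
  refine ⟨_ ⧸ Ideal.span {(2 : integralClosure ℤ ℂ)}, inferInstance,
    Ideal.Quotient.nontrivial_iff.2 hI, ?_, ⟨Ideal.Quotient.mk _⟩⟩
  rw [← map_ofNat (Ideal.Quotient.mk (Ideal.span {(2 : integralClosure ℤ ℂ)})) 2]
  exact Ideal.Quotient.eq_zero_iff_mem.2 (Ideal.mem_span_singleton_self _)

/-- The values of an irreducible character, as algebraic integers. -/
def integralValue {G : Type} [Group G] [Finite G] (χ : {χ // IsIrreducibleCharacter G χ}) (g : G) :
    integralClosure ℤ ℂ :=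
  ⟨χ.1 g, χ.2.isIntegral g⟩

theorem coprime_of_mul_self_modEq_one {k n : ℕ} (hk : k * k ≡ 1 [MOD n]) : k.Coprime n := by
  have h : (k * k).Coprime n := by
    rw [Nat.coprime_iff_gcd_eq_one, hk.gcd_eq, Nat.gcd_one_left]
  exact h.coprime_mul_right

section ReductionModTwo

variable {G : Type} [Group G] [Fintype G] {R : Type} [CommRing R] {k : ℕ}

theorem pow_pow_eq_self_of_modEq (hk : k * k ≡ 1 [MOD Fintype.card G]) (g : G) :
    (g ^ k) ^ k = g := by
  rw [← pow_mul, ← pow_mod_card, hk, pow_mod_card, pow_one]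

theorem sum_fixed_integralValue_mul_inv (h2 : (2 : R) = 0) (φ : integralClosure ℤ ℂ →+* R)
    (hodd : Odd (Fintype.card G)) (hk : k * k ≡ 1 [MOD Fintype.card G])
    {χ ψ : {χ // IsIrreducibleCharacter G χ}}
    (hχ : ∀ g, χ.1 (g ^ k) = χ.1 g) (hψ : ∀ g, ψ.1 (g ^ k) = ψ.1 g) :
    ∑ g with g ^ k = g, φ (integralValue χ g) * φ (integralValue ψ g⁻¹) =
      if χ = ψ then 1 else 0 := by
  have h : ∑ g, integralValue χ g * integralValue ψ g⁻¹ =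
      if χ = ψ then (Fintype.card G : integralClosure ℤ ℂ) else 0 := by
    apply Subtype.ext
    have := χ.2.sum_mul_inv ψ.2
    simp only [← Subtype.ext_iff] at this
    split_ifs with h <;> simpa [integralValue, h] using this
  have hn : ((Fintype.card G : ℕ) : R) = 1 := by
    obtain ⟨t, ht⟩ := hodd
    rw [ht]
    simp [h2]
  have h' := congrArg φ h
  rw [map_sum, apply_ite φ, map_natCast, map_zero, hn] at h'
  rw [← h', sum_eq_sum_fixedPoints_of_two_eq_zero h2 (fun g => g ^ k)
    (pow_pow_eq_self_of_modEq hk)]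
  · simp only [map_mul]
  · intro g
    have h3 : integralValue χ (g ^ k) = integralValue χ g := Subtype.ext (hχ g)
    have h4 : integralValue ψ (g ^ k)⁻¹ = integralValue ψ g⁻¹ := by
      rw [← inv_pow]
      exact Subtype.ext (hψ g⁻¹)
    rw [h3, h4]

theorem eq_of_forall_eq_on_fixed (hodd : Odd (Fintype.card G))
    (hk : k * k ≡ 1 [MOD Fintype.card G]) {χ ψ : G → ℂ} (hχi : IsIrreducibleCharacter G χ)
    (hψi : IsIrreducibleCharacter G ψ) (hχ : ∀ g, χ (g ^ k) = χ g) (hψ : ∀ g, ψ (g ^ k) = ψ g)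
    (h : ∀ g, g ^ k = g → χ g = ψ g) : χ = ψ := by
  obtain ⟨R, _, _, h2, ⟨φ⟩⟩ := exists_reduction_mod_two
  let χ' : {χ // IsIrreducibleCharacter G χ} := ⟨χ, hχi⟩
  let ψ' : {χ // IsIrreducibleCharacter G χ} := ⟨ψ, hψi⟩
  have h1 := sum_fixed_integralValue_mul_inv h2 φ hodd hk (χ := χ') (ψ := ψ') hχ hψ
  have h3 := sum_fixed_integralValue_mul_inv h2 φ hodd hk (χ := ψ') (ψ := ψ') hψ hψ
  rw [if_pos rfl] at h3
  have h4 : ∑ g with g ^ k = g, φ (integralValue χ' g) * φ (integralValue ψ' g⁻¹) = 1 := by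
    rw [← h3]
    refine Finset.sum_congr rfl fun g hg => ?_
    rw [show integralValue χ' g = integralValue ψ' g from
      Subtype.ext (h g (Finset.mem_filter.1 hg).2)]
  by_contra hne
  rw [h4, if_neg fun h => hne (congrArg Subtype.val h)] at h1
  exact one_ne_zero h1

theorem isIrreducibleCharacter_comp_pow {χ : G → ℂ} (hχ : IsIrreducibleCharacter G χ)
    (hk : k.Coprime (Fintype.card G)) : IsIrreducibleCharacter G (fun g => χ (g ^ k)) := by
  obtain ⟨τ, hτ⟩ := exists_ringEquiv_pow_of_coprime Fintype.card_ne_zero hk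
  have := hχ.ringEquiv_comp τ
  simpa only [hχ.ringEquiv_apply_eq_apply_pow Fintype.card_ne_zero pow_card_eq_one τ hτ] using this

theorem card_fixed_irreducibleCharacters (hodd : Odd (Fintype.card G))
    (hk : k * k ≡ 1 [MOD Fintype.card G]) :
    Nat.card {χ : {χ // IsIrreducibleCharacter G χ} // ∀ g, χ.1 (g ^ k) = χ.1 g} =
      Nat.card {c : ConjClasses G // ∃ g, c = ConjClasses.mk g ∧ g ^ k = g} := by
  obtain ⟨R, _, _, h2, ⟨φ⟩⟩ := exists_reduction_mod_two
  have hkc := coprime_of_mul_self_modEq_one hk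
  have := finite_irreducibleCharacters G
  let _ := Fintype.ofFinite {χ // IsIrreducibleCharacter G χ}
  let S := {χ : {χ // IsIrreducibleCharacter G χ} // ∀ g, χ.1 (g ^ k) = χ.1 g}
  let C := {c : ConjClasses G // ∃ g, c = ConjClasses.mk g ∧ g ^ k = g}
  choose r hr hrk using fun c : C => c.2
  have hfix : ∀ (c : C) (g : G), ConjClasses.mk g = c.1 → g ^ k = g := by
    intro c g hg
    rw [hr c, ConjClasses.mk_eq_mk_iff_isConj] at hg
    obtain ⟨h, hh⟩ := isConj_iff.1 hg.symm
    rw [← hh, conj_pow, hrk]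
  let y : {χ // IsIrreducibleCharacter G χ} → G → R := fun χ g => φ (integralValue χ g)
  have hy : ∀ (χ : {χ // IsIrreducibleCharacter G χ}) (g h : G),
      ConjClasses.mk g = ConjClasses.mk h → y χ g = y χ h := by
    intro χ g h hgh
    obtain ⟨x, hx⟩ := isConj_iff.1 (ConjClasses.mk_eq_mk_iff_isConj.1 hgh)
    exact congrArg φ (Subtype.ext (by rw [← hx]; exact (χ.2.conj_apply g x).symm))
  let A : Matrix S C R := fun χ c => ∑ g with ConjClasses.mk g = c.1, y χ.1 g⁻¹
  let B : Matrix C S R := fun c χ => y χ.1 (r c)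
  have hfib : ∀ F : G → R, ∑ c : C, ∑ g with ConjClasses.mk g = c.1, F g =
      ∑ g with g ^ k = g, F g := by
    intro F
    simp only [Finset.sum_filter]
    rw [Finset.sum_comm]
    refine Finset.sum_congr rfl fun g _ => ?_
    split_ifs with hg
    · rw [Finset.sum_eq_single ⟨ConjClasses.mk g, g, rfl, hg⟩]
      · simp
      · exact fun c _ hc => if_neg fun h => hc (Subtype.ext h.symm)
      · simp
    · exact Finset.sum_eq_zero fun c _ => if_neg fun h => hg (hfix c g h)
  have hAB : A * B = 1 := by
    ext χ ψ
    have h1 := sum_fixed_integralValue_mul_inv h2 φ hodd hk ψ.2 χ.2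
    rw [Matrix.mul_apply, Matrix.one_apply]
    simp only [eq_comm (a := χ), Subtype.ext_iff (a1 := ψ)] at h1 ⊢
    rw [← h1, ← hfib]
    refine Finset.sum_congr rfl fun c _ => ?_
    rw [Finset.sum_mul]
    refine Finset.sum_congr rfl fun g hg => ?_
    rw [mul_comm, show B c ψ = y ψ.1 g from
      hy _ _ _ ((hr c).symm.trans (Finset.mem_filter.1 hg).2.symm)]
  let σ : {χ // IsIrreducibleCharacter G χ} → {χ // IsIrreducibleCharacter G χ} :=
    fun χ => ⟨fun g => χ.1 (g ^ k), isIrreducibleCharacter_comp_pow χ.2 hkc⟩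
  have hσ : Function.Involutive σ := fun χ =>
    Subtype.ext (funext fun g => congrArg χ.1 (pow_pow_eq_self_of_modEq hk g))
  have hyσ : ∀ χ g, g ^ k = g → y (σ χ) g = y χ g := fun χ g hg =>
    congrArg φ (Subtype.ext (congrArg χ.1 hg))
  have hn : ((Fintype.card G : ℕ) : R) = 1 := by
    obtain ⟨t, ht⟩ := hodd
    rw [ht]
    simp [h2]
  have hBA : B * A = 1 := by
    ext c d
    have h1 : ∑ χ, integralValue χ (r c) * ∑ g with ConjClasses.mk g = d.1, integralValue χ g⁻¹ =
        if c = d then (Fintype.card G : integralClosure ℤ ℂ) else 0 := by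
      apply Subtype.ext
      have := sum_irreducibleCharacters_mul_sum_conj (r c) d.1
      simp only [← hr c, ← Subtype.ext_iff] at this
      split_ifs with h <;> simpa [integralValue, h] using this
    have h3 := congrArg φ h1
    rw [map_sum, apply_ite φ, map_natCast, map_zero, hn,
      sum_eq_sum_fixedPoints_of_two_eq_zero h2 σ hσ] at h3
    · rw [Matrix.mul_apply, Matrix.one_apply, ← h3]
      simp only [map_mul, map_sum]
      refine (Finset.sum_subtype (p := fun χ : {χ // IsIrreducibleCharacter G χ} =>
        ∀ g, χ.1 (g ^ k) = χ.1 g) _ (fun χ => ?_) (fun χ => y χ (r c) *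
          ∑ g with ConjClasses.mk g = d.1, y χ g⁻¹)).symm
      simp [σ, Subtype.ext_iff, funext_iff]
    · intro χ
      simp only [map_mul, map_sum]
      congr 1
      · exact hyσ χ _ (hrk c)
      · refine Finset.sum_congr rfl fun g hg => hyσ χ _ ?_
        rw [inv_pow, hfix d g (Finset.mem_filter.1 hg).2]
  have e : (S → R) ≃ₗ[R] (C → R) := Matrix.toLin'OfInv hAB hBA
  rw [Nat.card_eq_fintype_card, Nat.card_eq_fintype_card]
  exact card_eq_of_linearEquiv R e

end ReductionModTwo

theorem exists_forall_ringEquiv_fixed_of_mem_Qfield {p : ℕ} {x : ℂ} (hx : x ∈ Qfield p) :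
    ∃ b : ℕ, ∀ c ≥ b, ∀ τ : ℂ ≃+* ℂ, (∀ z : ℂ, z ^ p ^ c = 1 → τ z = z) → τ x = x := by
  induction hx using Subfield.closure_induction with
  | mem x hx =>
    obtain ⟨a, -, ha⟩ := hx
    refine ⟨a, fun c hc τ hτ => hτ x ?_⟩
    obtain ⟨d, rfl⟩ := Nat.exists_eq_add_of_le hc
    rw [pow_add, pow_mul, ha, one_pow]
  | one => exact ⟨0, fun c _ τ _ => map_one τ⟩
  | add x y _ _ hx hy =>
    obtain ⟨b, hb⟩ := hx
    obtain ⟨d, hd⟩ := hy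
    refine ⟨max b d, fun c hc τ hτ => ?_⟩
    rw [map_add, hb c (le_of_max_le_left hc) τ hτ, hd c (le_of_max_le_right hc) τ hτ]
  | neg x _ hx =>
    obtain ⟨b, hb⟩ := hx
    exact ⟨b, fun c hc τ hτ => by rw [map_neg, hb c hc τ hτ]⟩
  | inv x _ hx =>
    obtain ⟨b, hb⟩ := hx
    exact ⟨b, fun c hc τ hτ => by rw [map_inv₀, hb c hc τ hτ]⟩
  | mul x y _ _ hx hy =>
    obtain ⟨b, hb⟩ := hx
    obtain ⟨d, hd⟩ := hy
    refine ⟨max b d, fun c hc τ hτ => ?_⟩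
    rw [map_mul, hb c (le_of_max_le_left hc) τ hτ, hd c (le_of_max_le_right hc) τ hτ]

theorem exists_modEq_one_and_dvd_add_one {u m : ℕ} (h : u.Coprime m) (hm : m ≠ 0) :
    ∃ k, k ≡ 1 [MOD u] ∧ m ∣ k + 1 := by
  obtain ⟨k, hku, hkm⟩ := Nat.chineseRemainder h 1 (m - 1)
  refine ⟨k, hku, (Nat.modEq_zero_iff_dvd).1 ((hkm.add_right 1).trans ?_)⟩
  rw [Nat.sub_add_cancel (Nat.one_le_iff_ne_zero.2 hm)]
  exact Nat.modEq_zero_iff_dvd.2 dvd_rfl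

theorem mul_self_modEq_one_of_dvd_add_one {k m : ℕ} (h : m ∣ k + 1) : k * k ≡ 1 [MOD m] := by
  rw [← ZMod.natCast_eq_natCast_iff]
  have h1 : (k : ZMod m) + 1 = 0 := by exact_mod_cast (ZMod.natCast_eq_zero_iff (k + 1) m).2 h
  push_cast
  linear_combination ((k : ZMod m) - 1) * h1

theorem modEq_of_dvd_add_one {k l m : ℕ} (hk : m ∣ k + 1) (hl : m ∣ l + 1) : k ≡ l [MOD m] :=
  Nat.ModEq.add_right_cancel' 1
    ((Nat.modEq_zero_iff_dvd.2 hk).trans (Nat.modEq_zero_iff_dvd.2 hl).symm)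

theorem mul_self_modEq_one_mul {k u m : ℕ} (h : u.Coprime m) (hku : k ≡ 1 [MOD u])
    (hkm : m ∣ k + 1) : k * k ≡ 1 [MOD u * m] :=
  (Nat.modEq_and_modEq_iff_modEq_mul h).1 ⟨hku.mul hku, mul_self_modEq_one_of_dvd_add_one hkm⟩

theorem IsIrreducibleCharacter.mem_Qfield_of_orderOf_eq {p : ℕ} {G : Type} [Group G] {χ : G → ℂ}
    (hχ : IsIrreducibleCharacter G χ) (hp : p.Prime) {g : G} {j : ℕ} (hg : orderOf g = p ^ j) :
    χ g ∈ Qfield p := by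
  have hg' : g ^ p ^ (j + 1) = 1 := by
    rw [pow_succ, pow_mul, ← hg, pow_orderOf_eq_one, one_pow]
  obtain ⟨s, hs, h⟩ := hχ.exists_multiset_pow (pow_ne_zero _ hp.ne_zero) hg'
  have h1 := h 1
  rw [pow_one] at h1
  rw [h1]
  refine Subfield.multiset_sum_mem _ _ fun z hz => ?_
  obtain ⟨w, hw, rfl⟩ := Multiset.mem_map.1 hz
  rw [pow_one]
  exact Subfield.subset_closure ⟨j + 1, j.succ_pos, hs w hw⟩

section PElements

variable {p : ℕ} {G : Type} [Group G] [Fintype G] {a m k : ℕ}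

theorem pow_eq_self_iff_orderOf_eq_prime_pow (hp : p.Prime) (hodd : Odd (Fintype.card G))
    (hG : Fintype.card G = p ^ a * m) (hpm : ¬ p ∣ m) (hk1 : k ≡ 1 [MOD p ^ a])
    (hkm : m ∣ k + 1) (g : G) : g ^ k = g ↔ ∃ j, orderOf g = p ^ j := by
  have ho : orderOf g ∣ p ^ a * m := hG ▸ orderOf_dvd_card
  have hiff : g ^ k = g ↔ k ≡ 1 [MOD orderOf g] := by
    rw [← pow_eq_pow_iff_modEq, pow_one]
  rw [hiff]
  constructor
  · intro h
    have hd : (orderOf g).gcd m ∣ 2 := by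
      have h1 : k + 1 ≡ 2 [MOD (orderOf g).gcd m] :=
        (h.of_dvd (Nat.gcd_dvd_left _ _)).add_right 1
      exact (h1.dvd_iff dvd_rfl).1 ((Nat.gcd_dvd_right _ _).trans hkm)
    have hd' : Odd ((orderOf g).gcd m) :=
      hodd.of_dvd_nat ((Nat.gcd_dvd_left _ _).trans orderOf_dvd_card)
    have hc : (orderOf g).Coprime m := by
      rcases (Nat.dvd_prime Nat.prime_two).1 hd with h1 | h1
      · exact h1
      · rw [h1] at hd'
        exact absurd hd' (by decide)
    obtain ⟨j, -, hj⟩ := (Nat.dvd_prime_pow hp).1 (hc.dvd_of_dvd_mul_right ho)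
    exact ⟨j, hj⟩
  · rintro ⟨j, hj⟩
    rw [hj] at ho ⊢
    exact hk1.of_dvd ((((hp.coprime_iff_not_dvd).2 hpm).pow_left j).dvd_of_dvd_mul_right ho)

theorem IsIrreducibleCharacter.forall_mem_Qfield_iff {χ : G → ℂ}
    (hχ : IsIrreducibleCharacter G χ) (hp : p.Prime) (hodd : Odd (Fintype.card G))
    (hG : Fintype.card G = p ^ a * m) (hpm : ¬ p ∣ m) (hk1 : k ≡ 1 [MOD p ^ a])
    (hkm : m ∣ k + 1) : (∀ g, χ g ∈ Qfield p) ↔ ∀ g, χ (g ^ k) = χ g := by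
  have hcop : ∀ c, (p ^ c).Coprime m := fun c => ((hp.coprime_iff_not_dvd).2 hpm).pow_left c
  have hm : m ≠ 0 := fun h => hpm (h ▸ dvd_zero p)
  constructor
  · intro h g
    obtain ⟨b, hb⟩ := exists_forall_ringEquiv_fixed_of_mem_Qfield (h g)
    obtain ⟨l, hl1, hlm⟩ := exists_modEq_one_and_dvd_add_one (hcop (a + b)) hm
    have hN : p ^ (a + b) * m ≠ 0 := mul_ne_zero (pow_ne_zero _ hp.ne_zero) hm
    have hdvd : p ^ a ∣ p ^ (a + b) := pow_dvd_pow p (a.le_add_right b)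
    obtain ⟨τ, hτ⟩ := exists_ringEquiv_pow_of_coprime hN
      (coprime_of_mul_self_modEq_one (mul_self_modEq_one_mul (hcop (a + b)) hl1 hlm))
    have hgN : g ^ (p ^ (a + b) * m) = 1 :=
      orderOf_dvd_iff_pow_eq_one.1 (orderOf_dvd_card.trans (hG ▸ mul_dvd_mul_right hdvd m))
    have hlk : l ≡ k [MOD Fintype.card G] := by
      rw [hG]
      exact (Nat.modEq_and_modEq_iff_modEq_mul (hcop a)).1
        ⟨(hl1.of_dvd hdvd).trans hk1.symm, modEq_of_dvd_add_one hlm hkm⟩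
    have hgl : g ^ l = g ^ k := pow_eq_pow_iff_modEq.2 (hlk.of_dvd orderOf_dvd_card)
    rw [← hgl, ← hχ.ringEquiv_apply_eq_apply_pow hN hgN τ hτ]
    refine hb (a + b) (b.le_add_left a) τ fun z hz => ?_
    rw [hτ z (by rw [pow_mul, hz, one_pow])]
    rw [pow_eq_pow_mod l hz, hl1, ← pow_eq_pow_mod 1 hz, pow_one]
  · intro h g
    refine mem_of_forall_ringEquiv_fixed (Qfield p) (hχ.isIntegral g) fun τ hτ => ?_
    have hk : k * k ≡ 1 [MOD Fintype.card G] := hG ▸ mul_self_modEq_one_mul (hcop a) hk1 hkm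
    refine congrFun (eq_of_forall_eq_on_fixed hodd hk (hχ.ringEquiv_comp τ) hχ
      (fun g => congrArg τ (h g)) h fun x hx => ?_) g
    obtain ⟨j, hj⟩ :=
      (pow_eq_self_iff_orderOf_eq_prime_pow hp hodd hG hpm hk1 hkm x).1 hx
    exact hτ _ (hχ.mem_Qfield_of_orderOf_eq hp hj)

end PElements

/-- If `p` is a prime and `G` is a finite `p`-solvable group of odd order, then the
number of conjugacy classes of `p`-elements equals the number of `Q_p`-valued
irreducible characters. -/
theorem pElementClasses_eq_QpValuedIrrChars_of_odd (p : ℕ) (hp : p.Prime)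
    (G : Type) [Group G] [Fintype G] (hG : IsPSolvable p G)
    (hodd : Odd (Fintype.card G)) :
    (PElementClasses p G).ncard = (QpValuedIrrChars p G).ncard := by
  obtain ⟨a, m, hpm, hG'⟩ := Nat.exists_eq_pow_mul_and_not_dvd
    (Fintype.card_ne_zero (α := G)) p hp.ne_one
  have hcop : (p ^ a).Coprime m := ((hp.coprime_iff_not_dvd).2 hpm).pow_left a
  obtain ⟨k, hk1, hkm⟩ := exists_modEq_one_and_dvd_add_one hcop fun h => hpm (h ▸ dvd_zero p)
  have hk : k * k ≡ 1 [MOD Fintype.card G] := hG' ▸ mul_self_modEq_one_mul hcop hk1 hkm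
  have hcard := card_fixed_irreducibleCharacters hodd hk
  simp only [pow_eq_self_iff_orderOf_eq_prime_pow hp hodd hG' hpm hk1 hkm] at hcard
  rw [← Nat.card_coe_set_eq, ← Nat.card_coe_set_eq]
  refine hcard.symm.trans (Nat.card_congr ?_)
  exact (Equiv.subtypeSubtypeEquivSubtypeInter (IsIrreducibleCharacter G)
    (fun χ => ∀ g, χ (g ^ k) = χ g)).trans (Equiv.subtypeEquivRight fun χ => and_congr_right
      fun hχ => (hχ.forall_mem_Qfield_iff hp hodd hG' hpm hk1 hkm).symm)
end
end

section
/- Let p be a prime, let G be a finite p-solvable group, let N be a minimal normal subgroup of G that is a p-group, and let λ be an irreducible character of N. Then there exists an irreducible character χ of G such that χ is Q_p-valued and λ is a constituent of the restriction of χ to N (equivalently, χ is an irreducible constituent of the induced character λ^G). -/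
open scoped Classical

noncomputable section

namespace Representation

section Basic

variable {k G V W : Type*} [Field k] [Group G] [AddCommGroup V] [Module k V]
  [AddCommGroup W] [Module k W]

/-- Irreducibility in terms of stable subspaces. -/
theorem isIrreducible_iff_forall_submodule (ρ : Representation k G V) :
    ρ.IsIrreducible ↔ Nontrivial V ∧
      ∀ S : Submodule k V, (∀ g, ∀ v ∈ S, ρ g v ∈ S) → S = ⊥ ∨ S = ⊤ := by
  constructor
  · intro h
    refine ⟨?_, fun S hS => ?_⟩
    · by_contra hV
      rw [not_nontrivial_iff_subsingleton] at hV
      obtain ⟨a, b, hab⟩ := h.toNontrivial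
      exact hab (Subrepresentation.toSubmodule_injective (Subsingleton.elim _ _))
    · rcases h.eq_bot_or_eq_top (⟨S, fun g v hv => hS g v hv⟩ : Subrepresentation ρ) with h | h
      · left
        exact congrArg Subrepresentation.toSubmodule h
      · right
        exact congrArg Subrepresentation.toSubmodule h
  · rintro ⟨hV, h⟩
    refine @IsSimpleOrder.mk _ _ _ ⟨⊥, ⊤, fun hbt => ?_⟩ fun S => ?_
    · exact bot_ne_top (congrArg Subrepresentation.toSubmodule hbt : (⊥ : Submodule k V) = ⊤)
    · rcases h S.toSubmodule (fun g v hv => S.apply_mem_toSubmodule g hv) with h | h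
      · left
        exact Subrepresentation.toSubmodule_injective h
      · right
        exact Subrepresentation.toSubmodule_injective h

theorem IsIrreducible.nontrivial {ρ : Representation k G V} (h : ρ.IsIrreducible) :
    Nontrivial V :=
  ((isIrreducible_iff_forall_submodule ρ).1 h).1

theorem IsIrreducible.eq_bot_or_eq_top_of_stable {ρ : Representation k G V}
    (h : ρ.IsIrreducible) (S : Submodule k V) (hS : ∀ g, ∀ v ∈ S, ρ g v ∈ S) :
    S = ⊥ ∨ S = ⊤ :=
  ((isIrreducible_iff_forall_submodule ρ).1 h).2 S hS

/-- Irreducibility only depends on the operators by which the group acts. -/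
theorem IsIrreducible.of_forall_exists {H : Type*} [Group H] {ρ : Representation k G V}
    {σ : Representation k H V} (h : ρ.IsIrreducible) (hσ : ∀ g, ∃ x, σ x = ρ g) :
    σ.IsIrreducible := by
  refine (isIrreducible_iff_forall_submodule σ).2 ⟨h.nontrivial, fun S hS => ?_⟩
  refine h.eq_bot_or_eq_top_of_stable S fun g v hv => ?_
  obtain ⟨x, hx⟩ := hσ g
  exact hx ▸ hS x v hv

theorem IsIrreducible.bijective_of_ne_zero {ρ : Representation k G V} {σ : Representation k G W}
    (hρ : ρ.IsIrreducible) (hσ : σ.IsIrreducible) {f : V →ₗ[k] W} (hf : f ≠ 0)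
    (h : ∀ g v, f (ρ g v) = σ g (f v)) : Function.Bijective f := by
  have := hρ
  have := hσ
  have := IsIrreducible.bijective_or_eq_zero (f.intertwiningMap_of_isIntertwiningMap ρ σ h)
  refine this.resolve_right fun h0 => hf ?_
  ext v
  exact DFunLike.congr_fun h0 v

theorem IsIrreducible.surjective_of_ne_zero {ρ : Representation k G V} {σ : Representation k G W}
    (hσ : σ.IsIrreducible) {f : V →ₗ[k] W} (hf : f ≠ 0)
    (h : ∀ g v, f (ρ g v) = σ g (f v)) : Function.Surjective f := by
  have := hσ
  have := IsIrreducible.surjective_or_eq_zero (f.intertwiningMap_of_isIntertwiningMap ρ σ h)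
  refine this.resolve_right fun h0 => hf ?_
  ext v
  exact DFunLike.congr_fun h0 v

theorem IsIrreducible.exists_eq_smul [IsAlgClosed k] [FiniteDimensional k V]
    {ρ : Representation k G V} (h : ρ.IsIrreducible) (f : V →ₗ[k] V)
    (hf : ∀ g v, f (ρ g v) = ρ g (f v)) : ∃ c : k, ∀ v, f v = c • v := by
  have := h
  obtain ⟨c, hc⟩ := (IsIrreducible.algebraMap_intertwiningMap_bijective_of_isAlgClosed (ρ := ρ)).2
      (f.intertwiningMap_of_isIntertwiningMap ρ ρ hf)
  exact ⟨c, fun v => (DFunLike.congr_fun hc v).symm⟩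

/-- Every nonzero finite-dimensional representation has an irreducible subrepresentation. -/
theorem exists_irreducible_submodule [FiniteDimensional k V] [Nontrivial V]
    (ρ : Representation k G V) :
    ∃ S : Subrepresentation ρ, S.toRepresentation.IsIrreducible := by
  have hne : ∃ n, ∃ S : Subrepresentation ρ, S.toSubmodule ≠ ⊥ ∧
      Module.finrank k S.toSubmodule = n :=
    ⟨_, ⟨⊤, fun _ _ _ => Submodule.mem_top⟩, top_ne_bot, rfl⟩
  obtain ⟨S, hS, hn⟩ := Nat.find_spec hne
  refine ⟨S, (isIrreducible_iff_forall_submodule _).2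
    ⟨Submodule.nontrivial_iff_ne_bot.2 hS, fun T hT => ?_⟩⟩
  by_cases hT0 : T = ⊥
  · exact Or.inl hT0
  right
  have hstable : ∀ (g : G) ⦃v : V⦄, v ∈ T.map S.toSubmodule.subtype →
      ρ g v ∈ T.map S.toSubmodule.subtype := by
    rintro g _ ⟨v, hv, rfl⟩
    exact ⟨S.toRepresentation g v, hT g v hv, rfl⟩
  have hmin := Nat.find_min' hne ⟨⟨T.map S.toSubmodule.subtype, hstable⟩,
    fun h0 => hT0 (Submodule.map_injective_of_injective S.toSubmodule.subtype_injective
      (h0.trans (Submodule.map_bot _).symm)), rfl⟩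
  rw [← hn, Submodule.finrank_map_subtype_eq] at hmin
  exact Submodule.eq_top_of_finrank_eq (le_antisymm (Submodule.finrank_le _) hmin)

/-- A representation of a finite group all of whose endomorphisms are scalars is irreducible. -/
theorem isIrreducible_of_forall_exists_smul [Finite G] [CharZero k] [Nontrivial V]
    (ρ : Representation k G V)
    (h : ∀ f : V →ₗ[k] V, (∀ g v, f (ρ g v) = ρ g (f v)) → ∃ c : k, ∀ v, f v = c • v) :
    ρ.IsIrreducible := by
  have := Fintype.ofFinite G
  refine (isIrreducible_iff_forall_submodule ρ).2 ⟨inferInstance, fun S hS => ?_⟩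
  obtain ⟨π, hπ⟩ := S.subtype.exists_leftInverse_of_injective S.ker_subtype
  let q : V →ₗ[k] V := ∑ g : G, ρ g ∘ₗ S.subtype ∘ₗ π ∘ₗ ρ g⁻¹
  have hq : ∀ g v, q (ρ g v) = ρ g (q v) := by
    intro g v
    simp only [q, LinearMap.sum_apply, LinearMap.comp_apply, map_sum]
    refine Fintype.sum_equiv (Equiv.mulLeft g⁻¹) _ _ fun x => ?_
    simp [← Module.End.mul_apply, ← map_mul]
  have hqS : ∀ v, q v ∈ S := fun v => by
    simp only [q, LinearMap.sum_apply]
    exact S.sum_mem fun g _ => hS g _ (π (ρ g⁻¹ v)).2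
  have hqv : ∀ v ∈ S, q v = (Nat.card G : k) • v := fun v hv => by
    have : ∀ g : G, (ρ g ∘ₗ S.subtype ∘ₗ π ∘ₗ ρ g⁻¹) v = v := fun g => by
      have h1 : π (ρ g⁻¹ v) = ⟨ρ g⁻¹ v, hS _ _ hv⟩ :=
        LinearMap.congr_fun hπ ⟨ρ g⁻¹ v, hS _ _ hv⟩
      simp [h1]
    simp only [q, LinearMap.sum_apply, this]
    simp [Nat.card_eq_fintype_card, Nat.cast_smul_eq_nsmul]
  obtain ⟨c, hc⟩ := h q hq
  by_cases hc0 : c = 0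
  · left
    rw [Submodule.eq_bot_iff]
    intro v hv
    have := hqv v hv
    rw [hc, hc0, zero_smul] at this
    exact (smul_eq_zero.1 this.symm).resolve_left (Nat.cast_ne_zero.2 Nat.card_pos.ne')
  · right
    rw [Submodule.eq_top_iff']
    intro v
    have := hqS v
    rw [hc] at this
    exact (S.smul_mem_iff hc0).1 this

/-- **Burnside's theorem**: the operators of an irreducible representation over an
algebraically closed field span all endomorphisms. -/
theorem IsIrreducible.span_range_eq_top [IsAlgClosed k] [FiniteDimensional k V]
    {ρ : Representation k G V} (h : ρ.IsIrreducible) :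
    Submodule.span k (Set.range ρ) = (⊤ : Submodule k (Module.End k V)) := by
  have := h
  rw [eq_top_iff]
  rintro f -
  have : IsSemisimpleModule (MonoidAlgebra k G) ρ.asModule := inferInstance
  have hscalar : ∀ e : Module.End (MonoidAlgebra k G) ρ.asModule,
      ∃ c : k, ∀ v : V, ρ.asModuleEquiv (e (ρ.asModuleEquiv.symm v)) = c • v := fun e => by
    refine h.exists_eq_smul (ρ.asModuleEquiv.toLinearMap ∘ₗ
      e.restrictScalars k ∘ₗ ρ.asModuleEquiv.symm.toLinearMap) fun g v => ?_
    have h1 : ρ.asModuleEquiv.symm (ρ g v) =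
        MonoidAlgebra.of k G g • ρ.asModuleEquiv.symm v :=
      asModuleEquiv_symm_map_rho ρ g v
    simp only [LinearMap.comp_apply, LinearEquiv.coe_coe, LinearMap.restrictScalars_apply, h1]
    rw [map_smul, asModuleEquiv_map_smul, asAlgebraHom_of]
  let f' : Module.End (Module.End (MonoidAlgebra k G) ρ.asModule) ρ.asModule :=
    { toFun := fun v => ρ.asModuleEquiv.symm (f (ρ.asModuleEquiv v))
      map_add' := fun v w => by simp
      map_smul' := fun e v => by
        obtain ⟨c, hc⟩ := hscalar e
        obtain ⟨v, rfl⟩ := ρ.asModuleEquiv.symm.surjective v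
        apply ρ.asModuleEquiv.injective
        simp only [Module.End.smul_def, hc, RingHom.id_apply, map_smul,
          LinearEquiv.apply_symm_apply] }
  let b := Module.finBasis k V
  obtain ⟨r, hr⟩ := jacobson_density f' (Finset.univ.image fun i => ρ.asModuleEquiv.symm (b i))
  have hf : f = ρ.asAlgebraHom r := by
    refine b.ext fun i => ?_
    have := congrArg ρ.asModuleEquiv
      (hr (ρ.asModuleEquiv.symm (b i)) (Finset.mem_image_of_mem _ (Finset.mem_univ i)))
    rwa [asModuleEquiv_map_smul, LinearEquiv.apply_symm_apply] at this
  rw [hf, asAlgebraHom_def, MonoidAlgebra.lift_apply]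
  exact Submodule.sum_mem _ fun g _ =>
    Submodule.smul_mem _ _ (Submodule.subset_span ⟨g, rfl⟩)

end Basic

end Representation

/-- An injective homomorphism onto a normal subgroup, together with the induced conjugation
action on its source. -/
structure NormalEmbedding (N G : Type*) [Group N] [Group G] where
  /-- The underlying homomorphism. -/
  hom : N →* G
  injective : Function.Injective hom
  /-- The conjugation action of the ambient group. -/
  conj : G →* MulAut N
  hom_conj : ∀ g n, hom (conj g n) = g * hom n * g⁻¹

namespace NormalEmbedding

variable {N G : Type*} [Group N] [Group G] (i : NormalEmbedding N G)

theorem mul_hom (g : G) (n : N) : g * i.hom n = i.hom (i.conj g n) * g := by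
  rw [i.hom_conj, inv_mul_cancel_right]

theorem conj_hom (m n : N) : i.conj (i.hom m) n = m * n * m⁻¹ :=
  i.injective (by simp [i.hom_conj])

theorem range_normal : i.hom.range.Normal :=
  ⟨by rintro _ ⟨n, rfl⟩ g; exact ⟨i.conj g n, i.hom_conj g n⟩⟩

/-- The embedding into an intermediate subgroup. -/
def restrict (T : Subgroup G) (hT : i.hom.range ≤ T) : NormalEmbedding N T where
  hom := i.hom.codRestrict T fun n => hT ⟨n, rfl⟩
  injective _ _ h := i.injective (congrArg Subtype.val h)
  conj := i.conj.comp T.subtype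
  hom_conj g n := Subtype.ext (i.hom_conj g n)

@[simp] theorem restrict_hom_coe (T : Subgroup G) (hT : i.hom.range ≤ T) (n : N) :
    ((i.restrict T hT).hom n : G) = i.hom n := rfl

/-- The tautological embedding of a normal subgroup. -/
def ofNormal (N : Subgroup G) [N.Normal] : NormalEmbedding N G where
  hom := N.subtype
  injective := N.subtype_injective
  conj := MulAut.conjNormal
  hom_conj g n := MulAut.conjNormal_apply g n

variable {k W : Type*} [Field k] [AddCommGroup W] [Module k W] (ρ : Representation k N W)

/-- The inertia group of a representation. -/
def inertia : Subgroup G where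
  carrier := {g | ∃ X : W ≃ₗ[k] W, ∀ n w, X (ρ n w) = ρ (i.conj g n) (X w)}
  one_mem' := ⟨LinearEquiv.refl k W, by simp⟩
  mul_mem' := by
    rintro a b ⟨X, hX⟩ ⟨Y, hY⟩
    exact ⟨Y.trans X, fun n w => by simp [hX, hY]⟩
  inv_mem' := by
    rintro a ⟨X, hX⟩
    exact ⟨X.symm, fun n w => X.injective (by simp [hX])⟩

theorem mem_inertia {g : G} : g ∈ i.inertia ρ ↔
    ∃ X : W ≃ₗ[k] W, ∀ n w, X (ρ n w) = ρ (i.conj g n) (X w) := Iff.rfl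

theorem range_le_inertia : i.hom.range ≤ i.inertia ρ := by
  rintro _ ⟨m, rfl⟩
  refine ⟨LinearEquiv.ofLinearMap (ρ m) (ρ m⁻¹) ?_ ?_, fun n w => ?_⟩
  · ext w; simp
  · ext w; simp
  · simp [conj_hom, ← Module.End.mul_apply, ← map_mul]

theorem inertia_restrict (T : Subgroup G) (hT : i.hom.range ≤ T) (h : T ≤ i.inertia ρ) :
    (i.restrict T hT).inertia ρ = ⊤ :=
  eq_top_iff.2 fun t _ => h t.2

end NormalEmbedding

namespace Representation

section Isotypic

variable {k N G V W : Type*} [Field k] [Group N] [Group G] [AddCommGroup V] [Module k V]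
  [AddCommGroup W] [Module k W] (i : NormalEmbedding N G) {ρ : Representation k N W}
  {σ : Representation k G V}

theorem exists_intertwining_apply_ne_zero (hσ : σ.IsIrreducible) (hinv : i.inertia ρ = ⊤)
    (hf : ∃ f : V →ₗ[k] W, f ≠ 0 ∧ ∀ n v, f (σ (i.hom n) v) = ρ n (f v)) {v : V} (hv : v ≠ 0) :
    ∃ f : V →ₗ[k] W, (∀ n v, f (σ (i.hom n) v) = ρ n (f v)) ∧ f v ≠ 0 := by
  by_contra! hcon
  let S : Submodule k V :=
    ⨅ f : {f : V →ₗ[k] W // ∀ n v, f (σ (i.hom n) v) = ρ n (f v)}, f.1.ker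
  have hS : ∀ v, v ∈ S ↔ ∀ f : V →ₗ[k] W, (∀ n v, f (σ (i.hom n) v) = ρ n (f v)) → f v = 0 := by
    simp [S]
  have hstable : ∀ g, ∀ v ∈ S, σ g v ∈ S := fun g v hv => by
    rw [hS] at hv ⊢
    intro f hf
    obtain ⟨X, hX⟩ := (i.mem_inertia ρ).1 (hinv ▸ Subgroup.mem_top g)
    refine X.symm.injective ?_
    rw [map_zero]
    refine hv (X.symm.toLinearMap ∘ₗ f ∘ₗ σ g) fun n v => X.injective ?_
    simp only [LinearMap.comp_apply, LinearEquiv.coe_coe, LinearEquiv.apply_symm_apply, hX, ← hf,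
      ← Module.End.mul_apply, ← map_mul, i.mul_hom]
  rcases hσ.eq_bot_or_eq_top_of_stable S hstable with h | h
  · exact hv ((Submodule.eq_bot_iff S).1 h v ((hS v).2 hcon))
  · obtain ⟨f, hf0, hf⟩ := hf
    exact hf0 (LinearMap.ext fun v => (hS v).1 (h ▸ Submodule.mem_top) f hf)

/-- Over an invariant irreducible representation `W`, irreducible representations restrict
to multiples of `W`. -/
theorem exists_equiv_pi [IsAlgClosed k] [FiniteDimensional k V] [FiniteDimensional k W]
    (hρ : ρ.IsIrreducible) (hσ : σ.IsIrreducible) (hinv : i.inertia ρ = ⊤)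
    (hf : ∃ f : V →ₗ[k] W, f ≠ 0 ∧ ∀ n v, f (σ (i.hom n) v) = ρ n (f v)) :
    ∃ (e : ℕ) (J : V ≃ₗ[k] (Fin e → W)), ∀ n v j, J (σ (i.hom n) v) j = ρ n (J v j) := by
  let H : Submodule k (V →ₗ[k] W) :=
    { carrier := {f | ∀ n v, f (σ (i.hom n) v) = ρ n (f v)}
      add_mem' := fun {a b} ha hb n v => by simp [ha n v, hb n v]
      zero_mem' := fun n v => by simp
      smul_mem' := fun c a ha n v => by simp [ha n v] }
  let b := Module.finBasis k H
  let J : V →ₗ[k] (Fin (Module.finrank k H) → W) := LinearMap.pi fun j => (b j).1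
  have hJ : ∀ n v j, J (σ (i.hom n) v) j = ρ n (J v j) := fun n v j => (b j).2 n v
  have hinj : Function.Injective J := by
    rw [injective_iff_map_eq_zero]
    intro v hv
    by_contra hv0
    obtain ⟨f, hf, hfv⟩ := exists_intertwining_apply_ne_zero i hσ hinv hf hv0
    have h1 := congrArg (fun x : H => x.1 v) (b.sum_repr ⟨f, hf⟩)
    refine hfv (h1.symm.trans ?_)
    simp only [Submodule.coe_sum, Submodule.coe_smul, LinearMap.sum_apply, LinearMap.smul_apply]
    exact Finset.sum_eq_zero fun j _ => by rw [show (b j).1 v = 0 from congrFun hv j, smul_zero]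
  have hsurj : Function.Surjective J := by
    rw [← LinearMap.range_eq_top]
    by_contra hne
    obtain ⟨φ, hφ, hφJ⟩ := Submodule.exists_le_ker_of_lt_top _ (lt_top_iff_ne_top.2 hne)
    have hA : ∀ (A : Module.End k W) v, φ (fun j => A (J v j)) = 0 := by
      intro A v
      have : A ∈ Submodule.span k (Set.range ρ) := hρ.span_range_eq_top ▸ Submodule.mem_top
      induction this using Submodule.span_induction with
      | mem A hA =>
        obtain ⟨n, rfl⟩ := hA
        have : (fun j => ρ n (J v j)) = J (σ (i.hom n) v) := funext fun j => (hJ n v j).symm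
        rw [this]
        exact hφJ ⟨_, rfl⟩
      | zero => exact map_zero φ
      | add A B _ _ hA hB =>
        rw [← add_zero (0 : k)]
        nth_rw 1 [← hA]
        rw [← hB, ← map_add]
        rfl
      | smul c A _ hA =>
        rw [← smul_zero c, ← hA, ← map_smul]
        rfl
    refine hφ (LinearMap.pi_ext fun j w => ?_)
    rw [LinearMap.zero_apply]
    refine Fintype.linearIndependent_iff.1 b.linearIndependent (fun j => φ (Pi.single j w))
      (Subtype.ext (LinearMap.ext fun v => ?_)) j
    by_contra hv
    obtain ⟨ψ, hψ⟩ : ∃ ψ : Module.Dual k W,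
        ψ (((∑ j, φ (Pi.single j w) • b j : H) : V →ₗ[k] W) v) ≠ 0 := by
      by_contra! h
      exact hv ((Module.forall_dual_apply_eq_zero_iff k _).1 h)
    refine hψ ?_
    rw [← hA (ψ.smulRight w) v]
    simp only [Submodule.coe_sum, Submodule.coe_smul, LinearMap.sum_apply, LinearMap.smul_apply,
      map_sum, map_smul, LinearMap.smulRight_apply]
    conv_rhs => rw [← Finset.univ_sum_single (fun j => ψ (J v j) • w), map_sum]
    refine Finset.sum_congr rfl fun j _ => ?_
    rw [Pi.single_smul', map_smul, smul_eq_mul, smul_eq_mul, mul_comm]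
    rfl
  exact ⟨_, LinearEquiv.ofBijective J ⟨hinj, hsurj⟩, hJ⟩

end Isotypic

end Representation

namespace Representation

section Coinduction

variable {k G U : Type*} [Field k] [Group G] [AddCommGroup U] [Module k U] {T : Subgroup G}
  (ψ : Representation k T U)

/-- The functions supported on the subgroup inside the coinduced representation. -/
def coindExtend : U →ₗ[k] coindV T.subtype ψ where
  toFun u := ⟨fun y => if h : y ∈ T then ψ ⟨y, h⟩ u else 0, fun t y => by
    by_cases h : y ∈ T
    · have h' : (t : G) * y ∈ T := mul_mem t.2 h
      refine (dif_pos h').trans (Eq.trans ?_ (congrArg (ψ t) (dif_pos h)).symm)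
      rw [← Module.End.mul_apply, ← map_mul]
      rfl
    · have h' : (t : G) * y ∉ T := fun h' => h ((Subgroup.mul_mem_cancel_left T t.2).1 h')
      simp [h, h']⟩
  map_add' u v := by
    ext y
    by_cases h : y ∈ T <;> simp [h]
  map_smul' c u := by
    ext y
    by_cases h : y ∈ T <;> simp [h]

theorem coindExtend_apply_of_mem (u : U) {y : G} (h : y ∈ T) :
    (coindExtend ψ u).1 y = ψ ⟨y, h⟩ u := dif_pos h

theorem coindExtend_apply_of_notMem (u : U) {y : G} (h : y ∉ T) :
    (coindExtend ψ u).1 y = 0 := dif_neg h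

/-- Evaluation on the coinduced representation. -/
def coindEval (x : G) : coindV T.subtype ψ →ₗ[k] U :=
  LinearMap.proj x ∘ₗ Submodule.subtype _

@[simp] theorem coindEval_apply (x : G) (φ : coindV T.subtype ψ) :
    coindEval ψ x φ = φ.1 x := rfl

theorem coind_apply_val (g x : G) (φ : coindV T.subtype ψ) :
    (coind T.subtype ψ g φ).1 x = φ.1 (x * g) := rfl

theorem coindExtend_rho (t : T) (u : U) :
    coindExtend ψ (ψ t u) = coind T.subtype ψ t (coindExtend ψ u) := by
  ext y
  rw [coind_apply_val]
  by_cases h : y ∈ T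
  · have h' : y * t ∈ T := mul_mem h t.2
    rw [coindExtend_apply_of_mem _ _ h, coindExtend_apply_of_mem _ _ h', ← Module.End.mul_apply,
      ← map_mul]
    rfl
  · have h' : y * t ∉ T := fun h' => h ((Subgroup.mul_mem_cancel_right T t.2).1 h')
    rw [coindExtend_apply_of_notMem _ _ h, coindExtend_apply_of_notMem _ _ h']

theorem sum_coind_coindExtend [Fintype G] (φ : coindV T.subtype ψ) :
    ∑ x : G, coind T.subtype ψ x⁻¹ (coindExtend ψ (φ.1 x)) = (Nat.card T : k) • φ := by
  ext y
  have h1 : ∀ x : G, (coind T.subtype ψ x⁻¹ (coindExtend ψ (φ.1 x))).1 y =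
      if y * x⁻¹ ∈ T then φ.1 y else 0 := fun x => by
    rw [coind_apply_val]
    split_ifs with h
    · rw [coindExtend_apply_of_mem _ _ h, ← φ.2 ⟨_, h⟩ x]
      simp
    · exact coindExtend_apply_of_notMem _ _ h
  rw [AddSubmonoidClass.coe_finsetSum, Finset.sum_apply, Finset.sum_congr rfl fun x _ => h1 x,
    Fintype.sum_equiv ((Equiv.inv G).trans (Equiv.mulLeft y))
      (fun x => if y * x⁻¹ ∈ T then φ.1 y else 0) (fun z => if z ∈ T then φ.1 y else 0)
      fun x => rfl, ← Finset.sum_filter, Finset.sum_const, ← Nat.cast_smul_eq_nsmul k]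
  congr 2
  rw [Nat.card_eq_fintype_card, Fintype.card_subtype]

theorem card_mul_trace_coind [Fintype G] [FiniteDimensional k U] (g : G) :
    (Nat.card T : k) * LinearMap.trace k _ (coind T.subtype ψ g) =
      ∑ x : G, if h : x * g * x⁻¹ ∈ T then LinearMap.trace k U (ψ ⟨_, h⟩) else 0 := by
  have hsum : (Nat.card T : k) • coind T.subtype ψ g =
      ∑ x : G, (coind T.subtype ψ (g * x⁻¹) ∘ₗ coindExtend ψ) ∘ₗ coindEval ψ x := by
    refine LinearMap.ext fun φ => ?_
    rw [LinearMap.smul_apply, ← map_smul, ← sum_coind_coindExtend, map_sum, LinearMap.sum_apply]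
    exact Finset.sum_congr rfl fun x _ => by
      simp only [LinearMap.comp_apply, ← Module.End.mul_apply, ← map_mul, coindEval_apply]
  rw [← smul_eq_mul, ← map_smul, hsum, map_sum]
  refine Finset.sum_congr rfl fun x _ => ?_
  rw [LinearMap.trace_comp_comm']
  split_ifs with h
  · congr 1
    ext u
    simp only [LinearMap.comp_apply, coindEval_apply, coind_apply_val, ← mul_assoc]
    exact coindExtend_apply_of_mem _ _ h
  · rw [← map_zero (LinearMap.trace k U)]
    congr 1
    ext u
    simp only [LinearMap.comp_apply, coindEval_apply, coind_apply_val, ← mul_assoc]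
    exact coindExtend_apply_of_notMem _ _ h

theorem trace_coind_mem [Finite G] [CharZero k] [FiniteDimensional k U] (F : Subfield k)
    (hF : ∀ t, LinearMap.trace k U (ψ t) ∈ F) (g : G) :
    LinearMap.trace k _ (coind T.subtype ψ g) ∈ F := by
  have := Fintype.ofFinite G
  have h0 : (Nat.card T : k) ≠ 0 := Nat.cast_ne_zero.2 Nat.card_pos.ne'
  rw [← inv_mul_cancel_left₀ h0 (LinearMap.trace k _ _), card_mul_trace_coind]
  refine F.mul_mem (F.inv_mem (natCast_mem F _)) (F.sum_mem fun x _ => ?_)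
  split_ifs with h
  · exact hF _
  · exact F.zero_mem

variable {N W : Type*} [Group N] [AddCommGroup W] [Module k W] (i : NormalEmbedding N G)
  {ρ : Representation k N W}

/-- The Clifford correspondence: coinduction from the inertia group preserves irreducibility. -/
theorem isIrreducible_coind [IsAlgClosed k] [CharZero k] [Finite G] [FiniteDimensional k U]
    [FiniteDimensional k W] (hρ : ρ.IsIrreducible) {ψ : Representation k (i.inertia ρ) U}
    (hψ : ψ.IsIrreducible) (hf : ∃ f : U →ₗ[k] W, f ≠ 0 ∧
      ∀ n u, f (ψ ((i.restrict _ (i.range_le_inertia ρ)).hom n) u) = ρ n (f u)) :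
    (coind (i.inertia ρ).subtype ψ).IsIrreducible := by
  have := Fintype.ofFinite G
  obtain ⟨e, J, hJ⟩ := exists_equiv_pi _ hρ hψ (i.inertia_restrict ρ _ _ le_rfl) hf
  have : Nontrivial U := hψ.nontrivial
  have hext : ∀ u, (coindExtend ψ u).1 1 = u := fun u => by
    rw [coindExtend_apply_of_mem ψ u (one_mem _)]
    exact congrArg (· u) (map_one ψ)
  have : Nontrivial (coindV (i.inertia ρ).subtype ψ) := by
    obtain ⟨u, hu⟩ := exists_ne (0 : U)
    refine ⟨coindExtend ψ u, 0, fun h => hu ?_⟩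
    rw [← hext u, h]
    rfl
  refine isIrreducible_of_forall_exists_smul _ fun q hq => ?_
  let γ : G → U →ₗ[k] U := fun y => coindEval ψ y ∘ₗ q ∘ₗ coindExtend ψ
  have hγ : ∀ y t u, γ y (ψ t u) = (q (coindExtend ψ u)).1 (y * t) := fun y t u => by
    simp only [γ, LinearMap.comp_apply, coindExtend_rho, hq, coindEval_apply, coind_apply_val]
  have hγ1 : ∀ t u, γ 1 (ψ t u) = ψ t (γ 1 u) := fun t u => by
    rw [hγ, one_mul, ← mul_one (t : G)]
    exact (q (coindExtend ψ u)).2 t 1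
  have hγN : ∀ y n u, γ y (ψ ((i.restrict _ (i.range_le_inertia ρ)).hom n) u) =
      ψ ((i.restrict _ (i.range_le_inertia ρ)).hom (i.conj y n)) (γ y u) := fun y n u => by
    rw [hγ, NormalEmbedding.restrict_hom_coe, i.mul_hom]
    exact (q (coindExtend ψ u)).2 ((i.restrict _ (i.range_le_inertia ρ)).hom (i.conj y n)) y
  have hγ0 : ∀ y, y ∉ i.inertia ρ → γ y = 0 := by
    intro y hy
    by_contra hne
    let X : Fin e → Fin e → W →ₗ[k] W := fun a b =>
      LinearMap.proj a ∘ₗ J.toLinearMap ∘ₗ γ y ∘ₗ J.symm.toLinearMap ∘ₗ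
        LinearMap.single k (fun _ => W) b
    have hX : ∀ a b n w, X a b (ρ n w) = ρ (i.conj y n) (X a b w) := fun a b n w => by
      have h1 : J.symm (Pi.single b (ρ n w)) =
          ψ ((i.restrict _ (i.range_le_inertia ρ)).hom n) (J.symm (Pi.single b w)) := by
        refine J.injective (funext fun c => ?_)
        rw [hJ, J.apply_symm_apply, J.apply_symm_apply]
        by_cases hcb : c = b
        · subst hcb; simp
        · simp [hcb]
      simp only [X, LinearMap.comp_apply, LinearEquiv.coe_coe, LinearMap.coe_single, h1, hγN,
        LinearMap.proj_apply, hJ]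
    obtain ⟨a, b, hab⟩ : ∃ a b, X a b ≠ 0 := by
      by_contra! h
      refine hne (LinearMap.ext fun u => ?_)
      have h2 : J.toLinearMap ∘ₗ γ y ∘ₗ J.symm.toLinearMap = 0 :=
        LinearMap.pi_ext fun b w => funext fun a => LinearMap.congr_fun (h a b) w
      have h3 := LinearMap.congr_fun h2 (J u)
      simpa using h3
    let ρ' : Representation k N W := ρ.comp (i.conj y).toMonoidHom
    have hirr : ρ'.IsIrreducible :=
      hρ.of_forall_exists fun n => ⟨(i.conj y).symm n, by simp [ρ']⟩
    exact hy ⟨LinearEquiv.ofBijective (X a b) (hρ.bijective_of_ne_zero hirr hab (hX a b)), hX a b⟩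
  obtain ⟨c, hc⟩ := hψ.exists_eq_smul (γ 1) hγ1
  have hext' : ∀ u, q (coindExtend ψ u) = c • coindExtend ψ u := fun u => by
    refine Subtype.ext (funext fun y => ?_)
    by_cases hy : y ∈ i.inertia ρ
    · have h1 := hγ 1 ⟨y, hy⟩ u
      rw [hγ1, hc, map_smul, one_mul] at h1
      rw [← h1, ← coindExtend_apply_of_mem ψ u hy]
      rfl
    · refine (LinearMap.congr_fun (hγ0 y hy) u).trans ?_
      change (0 : U) = c • (coindExtend ψ u).1 y
      rw [coindExtend_apply_of_notMem ψ u hy, smul_zero]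
  refine ⟨c, fun φ => ?_⟩
  have h0 : (Nat.card (i.inertia ρ) : k) ≠ 0 := Nat.cast_ne_zero.2 Nat.card_pos.ne'
  refine smul_right_injective _ h0 ?_
  change (Nat.card (i.inertia ρ) : k) • q φ = (Nat.card (i.inertia ρ) : k) • c • φ
  rw [← map_smul, smul_comm, ← sum_coind_coindExtend, map_sum, Finset.smul_sum]
  exact Finset.sum_congr rfl fun x _ => by rw [hq, hext', map_smul]

/-- A constituent of the restriction lies below the coinduced representation. -/
theorem exists_coind_intertwining [Finite G] (hT : i.hom.range ≤ T)
    (hf : ∃ f : U →ₗ[k] W, f ≠ 0 ∧ ∀ n u, f (ψ ((i.restrict T hT).hom n) u) = ρ n (f u)) :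
    ∃ f : coindV T.subtype ψ →ₗ[k] W, f ≠ 0 ∧
      ∀ n φ, f (coind T.subtype ψ (i.hom n) φ) = ρ n (f φ) := by
  obtain ⟨f, hf0, hf⟩ := hf
  refine ⟨f ∘ₗ coindEval ψ 1, fun h => hf0 (LinearMap.ext fun u => ?_), fun n φ => ?_⟩
  · have := LinearMap.congr_fun h (coindExtend ψ u)
    rwa [LinearMap.comp_apply, coindEval_apply, coindExtend_apply_of_mem ψ u (one_mem _),
      show (⟨1, one_mem T⟩ : T) = 1 from rfl, map_one] at this
  · rw [LinearMap.comp_apply, LinearMap.comp_apply, coindEval_apply, coind_apply_val, one_mul,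
      ← hf, coindEval_apply, ← φ.2 ((i.restrict T hT).hom n) 1]
    simp

end Coinduction

end Representation

section Traces

variable {p : ℕ} {W : Type*} [AddCommGroup W] [Module ℂ W] [FiniteDimensional ℂ W]

theorem Module.End.pow_eq_one_of_mem_roots_charpoly {f : Module.End ℂ W} {m : ℕ} (h : f ^ m = 1)
    {μ : ℂ} (hμ : μ ∈ f.charpoly.roots) : μ ^ m = 1 := by
  have h1 : f.HasEigenvalue μ :=
    (hasEigenvalue_iff_isRoot_charpoly f μ).2 (Polynomial.isRoot_of_mem_roots hμ)
  obtain ⟨v, hv⟩ := h1.exists_hasEigenvector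
  have h2 := hv.pow_apply m
  rw [h, Module.End.one_apply] at h2
  refine smul_left_injective ℂ hv.2 ?_
  change μ ^ m • v = (1 : ℂ) • v
  rw [← h2, one_smul]

theorem Module.End.trace_eq_sum_roots_charpoly (f : Module.End ℂ W) :
    LinearMap.trace ℂ W f = f.charpoly.roots.sum :=
  trace_eq_sum_roots_charpoly_of_splits (IsAlgClosed.splits _)

theorem mem_Qfield_of_pow_eq_one {μ : ℂ} {a : ℕ} (h : μ ^ p ^ a = 1) : μ ∈ Qfield p :=
  Subfield.subset_closure ⟨a + 1, a.succ_pos, by rw [pow_succ, pow_mul, h, one_pow]⟩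

theorem trace_mem_Qfield_of_pow_eq_one {f : Module.End ℂ W} {a : ℕ} (h : f ^ p ^ a = 1) :
    LinearMap.trace ℂ W f ∈ Qfield p := by
  rw [f.trace_eq_sum_roots_charpoly]
  exact multiset_sum_mem _ fun μ hμ =>
    mem_Qfield_of_pow_eq_one (Module.End.pow_eq_one_of_mem_roots_charpoly h hμ)

theorem isIntegral_trace_of_pow_eq_one {f : Module.End ℂ W} {m : ℕ} (hm : 0 < m)
    (h : f ^ m = 1) : IsIntegral ℤ (LinearMap.trace ℂ W f) := by
  rw [f.trace_eq_sum_roots_charpoly]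
  refine IsIntegral.multiset_sum fun μ hμ => IsIntegral.of_pow hm ?_
  rw [Module.End.pow_eq_one_of_mem_roots_charpoly h hμ]
  exact isIntegral_one

theorem LinearMap.eq_of_forall_trace_mul_eq {f g : Module.End ℂ W}
    (h : ∀ x : Module.End ℂ W, LinearMap.trace ℂ W (x * f) = LinearMap.trace ℂ W (x * g)) :
    f = g := by
  let b := Module.finBasis ℂ W
  refine (LinearMap.toMatrix b b).injective (Matrix.ext_iff_trace_mul_left.2 fun x => ?_)
  have := h (Matrix.toLin b b x)
  rwa [LinearMap.trace_eq_matrix_trace ℂ b, LinearMap.trace_eq_matrix_trace ℂ b,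
    LinearMap.toMatrix_mul, LinearMap.toMatrix_mul, LinearMap.toMatrix_toLin] at this

theorem Module.End.det_mulLeft (f : Module.End ℂ W) :
    LinearMap.det (LinearMap.mulLeft ℂ f) = LinearMap.det f ^ Module.finrank ℂ W := by
  let b := Module.finBasis ℂ W
  let e : Module.End ℂ W ≃ₗ[ℂ] (Fin (Module.finrank ℂ W) → W) := (b.constr ℂ).symm
  have h : e.toLinearMap ∘ₗ LinearMap.mulLeft ℂ f ∘ₗ e.symm.toLinearMap =
      LinearMap.pi fun j => f ∘ₗ LinearMap.proj j := by
    ext x j k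
    simp [e]
  rw [← LinearMap.det_conj _ e, h, LinearMap.det_pi]
  simp

/-- If a subalgebra over a subfield `F` spans all endomorphisms and has traces in `F`, then
a power of the determinant of each of its elements is in `F`. -/
theorem det_pow_finrank_mem {F : Subfield ℂ} (R : Subalgebra F (Module.End ℂ W))
    (hspan : Submodule.span ℂ (R : Set (Module.End ℂ W)) = ⊤)
    (htr : ∀ x ∈ R, LinearMap.trace ℂ W x ∈ F) {x : Module.End ℂ W} (hx : x ∈ R) :
    LinearMap.det x ^ Module.finrank ℂ W ∈ F := by
  let b := Module.Basis.ofSpan hspan.ge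
  have hb : ∀ j, b j ∈ R := fun j => Module.Basis.ofSpan_subset hspan.ge ⟨j, rfl⟩
  have := Module.Basis.fintypeIndexOfRankLtAleph0 b (Module.rank_lt_aleph0 ℂ _)
  obtain ⟨π, hπ⟩ := (Algebra.linearMap F ℂ).exists_leftInverse_of_injective
    (LinearMap.ker_eq_bot.2 Subtype.val_injective)
  have hπF : ∀ c (hc : c ∈ F), (π c : ℂ) = c := fun c hc =>
    congrArg Subtype.val (LinearMap.congr_fun hπ ⟨c, hc⟩)
  have hπmul : ∀ c, ∀ d ∈ F, (π (c * d) : ℂ) = π c * d := fun c d hd => by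
    have := congrArg Subtype.val (π.map_smul ⟨d, hd⟩ c)
    rw [mul_comm, mul_comm (π c : ℂ)]
    exact this
  have hcoord : ∀ y ∈ R, ∀ j, b.repr y j ∈ F := by
    intro y hy j
    let y' := ∑ j, (π (b.repr y j) : ℂ) • b j
    have h1 : ∀ i, LinearMap.trace ℂ W (b i * y') = LinearMap.trace ℂ W (b i * y) := by
      intro i
      rw [← hπF _ (htr _ (R.mul_mem (hb i) hy))]
      conv_rhs => rw [← b.sum_repr y]
      simp only [y', Finset.mul_sum, map_sum, mul_smul_comm, map_smul, smul_eq_mul,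
        AddSubmonoidClass.coe_finsetSum]
      exact Finset.sum_congr rfl fun j _ =>
        (hπmul _ _ (htr _ (R.mul_mem (hb i) (hb j)))).symm
    have h2 : y' = y := LinearMap.eq_of_forall_trace_mul_eq fun z => by
      rw [← b.sum_repr z]
      simp only [Finset.sum_mul, map_sum, smul_mul_assoc, map_smul, h1]
    have h3 : b.repr y' j = π (b.repr y j) := by
      rw [b.repr_sum_self]
    rw [← h2, h3]
    exact SetLike.coe_mem _
  rw [← Module.End.det_mulLeft, ← LinearMap.det_toMatrix b, Matrix.det_apply]
  refine F.sum_mem fun σ _ => ?_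
  rw [Units.smul_def]
  refine zsmul_mem (F.prod_mem fun j _ => ?_) _
  rw [LinearMap.toMatrix_apply]
  exact hcoord _ (R.mul_mem hx (hb j)) _

end Traces

namespace Representation

theorem adjoin_image_eq_span {A k N W : Type*} [CommSemiring A] [Field k] [Group N]
    [AddCommGroup W] [Module k W] [Algebra A (Module.End k W)] (ρ : Representation k N W)
    (P : Subgroup N) :
    Subalgebra.toSubmodule (Algebra.adjoin A (ρ '' P)) = Submodule.span A (ρ '' P) := by
  rw [Algebra.adjoin_eq_span]
  congr 1
  exact congrArg SetLike.coe (Submonoid.closure_eq (P.toSubmonoid.map ρ))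

section GroupTraces

variable {p : ℕ} {W : Type*} [AddCommGroup W] [Module ℂ W] [FiniteDimensional ℂ W]
  {N : Type*} [Group N] (ρ : Representation ℂ N W)

theorem trace_mem_Qfield_of_mem_adjoin {P : Subgroup N} (hP : IsPGroup p P)
    {f : Module.End ℂ W} (hf : f ∈ Algebra.adjoin (Qfield p) (ρ '' P)) :
    LinearMap.trace ℂ W f ∈ Qfield p := by
  rw [← Subalgebra.mem_toSubmodule, adjoin_image_eq_span] at hf
  induction hf using Submodule.span_induction with
  | mem f hf =>
    obtain ⟨x, hx, rfl⟩ := hf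
    obtain ⟨a, ha⟩ := hP ⟨x, hx⟩
    refine trace_mem_Qfield_of_pow_eq_one (a := a) ?_
    rw [← map_pow, show x ^ p ^ a = 1 from congrArg Subtype.val ha, map_one]
  | zero => rw [map_zero]; exact zero_mem _
  | add f g _ _ hf hg => rw [map_add]; exact add_mem hf hg
  | smul c f _ hf =>
    rw [show c • f = (c : ℂ) • f from rfl, map_smul]
    exact mul_mem c.2 hf

/-- The dimension of an irreducible representation divides the group order. -/
theorem IsIrreducible.finrank_dvd_card [Finite N] {ρ : Representation ℂ N W}
    (h : ρ.IsIrreducible) : Module.finrank ℂ W ∣ Nat.card N := by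
  have := Fintype.ofFinite N
  have := h.nontrivial
  have hn0 : (Module.finrank ℂ W : ℂ) ≠ 0 := Nat.cast_ne_zero.2 Module.finrank_pos.ne'
  have hc0 : (Nat.card N : ℂ) ≠ 0 := Nat.cast_ne_zero.2 Nat.card_pos.ne'
  let A := integralClosure ℤ ℂ
  let z : Module.End ℂ W := ∑ x : N, ρ.character x • ρ x⁻¹
  obtain ⟨c, hc⟩ := h.exists_eq_smul z fun g v => by
    simp only [z, LinearMap.sum_apply, map_sum, LinearMap.smul_apply, map_smul]
    refine Fintype.sum_equiv (MulAut.conj g⁻¹).toEquiv _ _ fun x => ?_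
    simp only [MulEquiv.toEquiv_eq_coe, EquivLike.coe_coe, MulAut.conj_apply, char_conj,
      ← Module.End.mul_apply, ← map_mul]
    congr 3
    group
  have hz : z = algebraMap ℂ (Module.End ℂ W) c := LinearMap.ext hc
  have hcn : c * Module.finrank ℂ W = Nat.card N := by
    have h1 : LinearMap.trace ℂ W z = c * Module.finrank ℂ W := by
      rw [hz, Algebra.algebraMap_eq_smul_one, map_smul, LinearMap.trace_one, smul_eq_mul]
    have : Invertible (Nat.card N : ℂ) := invertibleOfNonzero hc0
    have h2 := char_orthonormal ρ ρ
    rw [if_pos ⟨Equiv.refl ρ⟩, inv_mul_eq_iff_eq_mul₀ hc0, mul_one] at h2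
    simp only [← h1, ← h2, z, map_sum, map_smul, smul_eq_mul]
    rfl
  have hz_int : IsIntegral A z := by
    refine IsIntegral.of_mem_of_fg (Algebra.adjoin A (ρ '' (⊤ : Subgroup N))) ?_ z ?_
    · rw [adjoin_image_eq_span]
      exact Submodule.fg_span (Set.toFinite _)
    · refine Subalgebra.sum_mem _ fun x _ => ?_
      have hx : IsIntegral ℤ (ρ.character x) := by
        refine isIntegral_trace_of_pow_eq_one (Nat.card_pos (α := N)) ?_
        rw [← map_pow, pow_card_eq_one', map_one]
      exact Subalgebra.smul_mem _
        (Algebra.subset_adjoin (Set.mem_image_of_mem _ (Subgroup.mem_top _))) (⟨_, hx⟩ : A)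
  rw [hz, isIntegral_algebraMap_iff (FaithfulSMul.algebraMap_injective _ _)] at hz_int
  have hz_int' : IsIntegral ℤ c := isIntegral_trans c hz_int
  have hq : c = algebraMap ℚ ℂ ((Nat.card N : ℚ) / Module.finrank ℂ W) := by
    rw [eq_div_of_mul_eq hn0 hcn]
    simp
  rw [hq, isIntegral_algebraMap_iff (algebraMap ℚ ℂ).injective,
    IsIntegrallyClosed.isIntegral_iff] at hz_int'
  obtain ⟨m, hm⟩ := hz_int'
  have hm' : (Nat.card N : ℚ) = Module.finrank ℂ W * m := by
    rw [mul_comm]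
    exact (div_eq_iff (Nat.cast_ne_zero.2 Module.finrank_pos.ne')).1 hm.symm
  exact Int.natCast_dvd_natCast.1 ⟨m, by exact_mod_cast hm'⟩

end GroupTraces

end Representation

namespace Representation

/-- An irreducible representation which, up to `p`-power roots of unity, is defined over the
subalgebra generated by a Sylow `p`-subgroup, and whose determinant has `p`-power order. -/
structure IsPRational (p : ℕ) {N W : Type*} [Group N] [AddCommGroup W] [Module ℂ W]
    (ρ : Representation ℂ N W) : Prop where
  irreducible : ρ.IsIrreducible
  exists_subgroup : ∃ P : Subgroup N, IsPGroup p P ∧ ¬ p ∣ P.index ∧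
    ∀ n, ρ n ∈ Algebra.adjoin (Qfield p) (ρ '' P)
  det_pow : ∀ n, ∃ a : ℕ, LinearMap.det (ρ n) ^ p ^ a = 1

section

variable {p : ℕ} {N W : Type*} [Group N] [AddCommGroup W] [Module ℂ W] [FiniteDimensional ℂ W]
  {ρ : Representation ℂ N W}

theorem IsPRational.trace_mem (hρ : ρ.IsPRational p) (n : N) :
    LinearMap.trace ℂ W (ρ n) ∈ Qfield p := by
  obtain ⟨P, hP, -, hR⟩ := hρ.exists_subgroup
  exact trace_mem_Qfield_of_mem_adjoin ρ hP (hR n)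

theorem IsPRational.exists_finrank_eq [Finite N] [Fact p.Prime] (hρ : ρ.IsPRational p) :
    ∃ a, Module.finrank ℂ W = p ^ a := by
  obtain ⟨P, hP, -, hR⟩ := hρ.exists_subgroup
  let ρ' : Representation ℂ P W := ρ.comp P.subtype
  have hirr : ρ'.IsIrreducible := by
    refine (isIrreducible_iff_forall_submodule _).2 ⟨hρ.irreducible.nontrivial, fun S hS => ?_⟩
    refine hρ.irreducible.eq_bot_or_eq_top_of_stable S fun n => ?_
    have h : ∀ A ∈ Algebra.adjoin (Qfield p) (ρ '' P), ∀ v ∈ S, A v ∈ S := fun A hA => by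
      induction hA using Algebra.adjoin_induction with
      | mem A hA =>
        obtain ⟨x, hx, rfl⟩ := hA
        exact hS ⟨x, hx⟩
      | algebraMap c => exact fun v hv => S.smul_mem (c : ℂ) hv
      | add A B _ _ hA hB => exact fun v hv => S.add_mem (hA v hv) (hB v hv)
      | mul A B _ _ hA hB => exact fun v hv => hA _ (hB v hv)
    exact h _ (hR n)
  obtain ⟨m, hm⟩ := IsPGroup.iff_card.1 hP
  have := hirr.finrank_dvd_card
  rw [hm, Nat.dvd_prime_pow Fact.out] at this
  exact this.imp fun _ h => h.2

end

section

variable {k : Type*} [Field k] {N G W : Type} [Group N] [Group G] [Finite G] [AddCommGroup W]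
  [Module k W] [FiniteDimensional k W] (i : NormalEmbedding N G)

/-- Every nonzero representation of a normal subgroup lies below an irreducible one. -/
theorem exists_irreducible_intertwining [Nontrivial W] (ρ : Representation k N W) :
    ∃ (V : Type) (_ : AddCommGroup V) (_ : Module k V) (_ : FiniteDimensional k V)
      (σ : Representation k G V), σ.IsIrreducible ∧
      ∃ f : V →ₗ[k] W, f ≠ 0 ∧ ∀ n v, f (σ (i.hom n) v) = ρ n (f v) := by
  let ψ : Representation k i.hom.range W :=
    ρ.comp (MonoidHom.ofInjective i.injective).symm.toMonoidHom
  have hψ : ∀ n, ψ ((i.restrict _ le_rfl).hom n) = ρ n := fun n =>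
    congrArg ρ ((MonoidHom.ofInjective i.injective).symm_apply_apply n)
  obtain ⟨w, hw⟩ := exists_ne (0 : W)
  have : Nontrivial (coindV i.hom.range.subtype ψ) := by
    refine ⟨coindExtend ψ w, 0, fun h => hw ?_⟩
    have h1 := coindExtend_apply_of_mem ψ w (one_mem _)
    rw [h, show (⟨1, one_mem _⟩ : i.hom.range) = 1 from rfl, map_one] at h1
    exact h1.symm
  obtain ⟨S, hS⟩ := exists_irreducible_submodule (coind i.hom.range.subtype ψ)
  refine ⟨S.toSubmodule, inferInstance, inferInstance, inferInstance, S.toRepresentation, hS,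
    coindEval ψ 1 ∘ₗ S.toSubmodule.subtype, fun h0 => ?_, fun n φ => ?_⟩
  · have := hS.nontrivial
    obtain ⟨φ, hφ⟩ := exists_ne (0 : S.toSubmodule)
    refine hφ (Subtype.ext (Subtype.ext (funext fun g => ?_)))
    have h1 := LinearMap.congr_fun h0 (S.toRepresentation g φ)
    have h2 : (coindEval ψ 1 ∘ₗ S.toSubmodule.subtype) (S.toRepresentation g φ) =
      φ.1.1 (1 * g) := rfl
    rw [h2, one_mul] at h1
    exact h1
  · have h2 : (coindEval ψ 1 ∘ₗ S.toSubmodule.subtype) (S.toRepresentation (i.hom n) φ) =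
      φ.1.1 (1 * i.hom n) := rfl
    rw [h2, ← hψ, one_mul, ← mul_one (i.hom n)]
    exact φ.1.2 ((i.restrict _ le_rfl).hom n) 1

end

section

variable {p : ℕ} [Fact p.Prime] {N G W : Type} [Group N] [Group G] [Finite G] [AddCommGroup W]
  [Module ℂ W] [FiniteDimensional ℂ W] (i : NormalEmbedding N G) {ρ : Representation ℂ N W}

theorem IsPRational.of_index_eq_pow {V : Type*} [AddCommGroup V] [Module ℂ V]
    [FiniteDimensional ℂ V] {σ : Representation ℂ G V} (hρ : ρ.IsPRational p)
    (hσ : σ.IsIrreducible) (hinv : i.inertia ρ = ⊤) {a : ℕ} (ha : i.hom.range.index = p ^ a)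
    (hf : ∃ f : V →ₗ[ℂ] W, f ≠ 0 ∧ ∀ n v, f (σ (i.hom n) v) = ρ n (f v)) :
    σ.IsPRational p := by
  have := i.range_normal
  obtain ⟨e, J, hJ⟩ := exists_equiv_pi i hρ.irreducible hσ hinv hf
  have hJσ : ∀ n, σ (i.hom n) =
      J.symm.toLinearMap ∘ₗ (ρ n).compLeft (Fin e) ∘ₗ J.toLinearMap := fun n =>
    LinearMap.ext fun v => J.injective (funext fun j => by simp [hJ])
  obtain ⟨P, hP, hPi, hR⟩ := hρ.exists_subgroup
  obtain ⟨S, hS⟩ := (hP.map i.hom).exists_le_sylow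
  have hadj : ∀ A ∈ Algebra.adjoin (Qfield p) (ρ '' P),
      J.symm.toLinearMap ∘ₗ A.compLeft (Fin e) ∘ₗ J.toLinearMap ∈
        Algebra.adjoin (Qfield p) (σ '' S) := fun A hA => by
    induction hA using Algebra.adjoin_induction with
    | mem A hA =>
      obtain ⟨x, hx, rfl⟩ := hA
      rw [← hJσ]
      exact Algebra.subset_adjoin ⟨_, hS ⟨x, hx, rfl⟩, rfl⟩
    | algebraMap c =>
      convert Subalgebra.algebraMap_mem _ c
      refine LinearMap.ext fun v => J.injective (funext fun j => ?_)
      have h1 : (algebraMap (Qfield p) (Module.End ℂ V) c) v = (c : ℂ) • v := rfl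
      have h2 : ∀ w : W, (algebraMap (Qfield p) (Module.End ℂ W) c) w = (c : ℂ) • w := fun _ => rfl
      rw [h1]
      simp [h2]
    | add A B _ _ hA hB =>
      convert add_mem hA hB
      refine LinearMap.ext fun v => J.injective (funext fun j => ?_)
      simp
    | mul A B _ _ hA hB =>
      convert mul_mem hA hB
      refine LinearMap.ext fun v => J.injective (funext fun j => ?_)
      simp
  refine ⟨hσ, ⟨S, S.isPGroup', S.not_dvd_index, fun g => ?_⟩, fun g => ?_⟩
  · have htop : i.hom.range ⊔ S = ⊤ := by
      rw [← Subgroup.index_eq_one]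
      have h1 := Subgroup.index_dvd_of_le (le_sup_left : i.hom.range ≤ i.hom.range ⊔ S)
      have h2 := Subgroup.index_dvd_of_le (le_sup_right : (S : Subgroup G) ≤ i.hom.range ⊔ S)
      rw [ha] at h1
      exact Nat.eq_one_of_dvd_coprimes (((Nat.Prime.coprime_iff_not_dvd Fact.out).2
        S.not_dvd_index).pow_left a) h1 h2
    obtain ⟨_, ⟨n, rfl⟩, s, hs, rfl⟩ :=
      Subgroup.mem_sup_of_normal_left.1 (htop ▸ Subgroup.mem_top g)
    rw [map_mul]
    refine mul_mem ?_ (Algebra.subset_adjoin ⟨s, hs, rfl⟩)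
    rw [hJσ]
    exact hadj _ (hR n)
  · obtain ⟨n, hn⟩ := i.hom.range.pow_index_mem g
    rw [ha] at hn
    obtain ⟨b, hb⟩ := hρ.det_pow n
    refine ⟨a + b, ?_⟩
    have hdet : LinearMap.det (σ (i.hom n)) = LinearMap.det (ρ n) ^ e := by
      have h := LinearMap.det_conj ((ρ n).compLeft (Fin e)) J.symm
      rw [J.symm_symm, ← hJσ] at h
      rw [h]
      exact (LinearMap.det_pi fun _ : Fin e => ρ n).trans (by simp)
    rw [pow_add, pow_mul, ← map_pow LinearMap.det, ← map_pow σ, ← hn, hdet, pow_right_comm, hb,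
      one_pow]

end

end Representation

/-- If `Γ` is a central extension of a group of order `k` by `Z` modulo a normal subgroup
meeting `Z` trivially, then the `k`-th power map induces a homomorphism from `Γ` to `Z`. -/
theorem exists_monoidHom_pow_index {Γ N Z : Type*} [Group Γ] [Group N] [CommGroup Z]
    (ν : N →* Γ) (s : Z →* Γ) (hν : ν.range.Normal) (hs : ∀ z γ, s z * γ = γ * s z)
    (hdisj : ∀ z, s z ∈ ν.range → z = 1) (hk : (ν.range ⊔ s.range).index ≠ 0) :
    ∃ c : Γ →* Z, ∀ γ, γ ^ (ν.range ⊔ s.range).index * (s (c γ))⁻¹ ∈ ν.range := by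
  let π := QuotientGroup.mk' ν.range
  have hle : ν.range ⊔ s.range ≤ (Subgroup.center (Γ ⧸ ν.range)).comap π := by
    refine sup_le ?_ ?_
    · rintro _ ⟨n, rfl⟩
      rw [Subgroup.mem_comap, show π (ν n) = 1 from (QuotientGroup.eq_one_iff _).2 ⟨n, rfl⟩]
      exact one_mem _
    · rintro _ ⟨z, rfl⟩
      rw [Subgroup.mem_comap, Subgroup.mem_center_iff]
      intro x
      obtain ⟨γ, rfl⟩ := QuotientGroup.mk'_surjective ν.range x
      rw [← map_mul, ← map_mul, hs]
  have hdvd := Subgroup.index_dvd_of_le hle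
  rw [Subgroup.index_comap_of_surjective _ (QuotientGroup.mk'_surjective _)] at hdvd
  have : (Subgroup.center (Γ ⧸ ν.range)).FiniteIndex := ⟨fun h => hk (by
    rw [h] at hdvd; exact zero_dvd_iff.1 hdvd)⟩
  obtain ⟨d, hd⟩ := hdvd
  have hmul : ∀ x y : Γ ⧸ ν.range, (x * y) ^ (ν.range ⊔ s.range).index =
      x ^ (ν.range ⊔ s.range).index * y ^ (ν.range ⊔ s.range).index := fun x y => by
    have h := congrArg Subtype.val (map_mul (MonoidHom.transferCenterPow (Γ ⧸ ν.range)) x y)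
    simp only [MonoidHom.transferCenterPow_apply, Subgroup.coe_mul] at h
    rw [hd, pow_mul, pow_mul, pow_mul, h]
    refine Commute.mul_pow (Subgroup.mem_center_iff.1 ?_ _ |>.symm) d
    exact (MonoidHom.transferCenterPow (Γ ⧸ ν.range) x).2
  have : (ν.range ⊔ s.range).Normal := by
    have : s.range.Normal := ⟨by
      rintro _ ⟨z, rfl⟩ γ
      rw [← hs, mul_inv_cancel_right]
      exact ⟨z, rfl⟩⟩
    infer_instance
  have hex : ∀ γ, ∃ z, γ ^ (ν.range ⊔ s.range).index * (s z)⁻¹ ∈ ν.range := fun γ => by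
    obtain ⟨y, hy, _, ⟨z, rfl⟩, hyz⟩ :=
      Subgroup.mem_sup_of_normal_left.1 ((ν.range ⊔ s.range).pow_index_mem γ)
    exact ⟨z, by rwa [← hyz, mul_inv_cancel_right]⟩
  have hπ : ∀ γ z, γ ^ (ν.range ⊔ s.range).index * (s z)⁻¹ ∈ ν.range ↔
      π (s z) = π γ ^ (ν.range ⊔ s.range).index := fun γ z => by
    rw [← QuotientGroup.eq_one_iff, ← map_pow, eq_comm (a := π _), ← mul_inv_eq_one (a := π _),
      ← map_inv π, ← map_mul π]
    rfl
  have hinj : Function.Injective (π.comp s) := by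
    rw [injective_iff_map_eq_one]
    exact fun z hz => hdisj z ((QuotientGroup.eq_one_iff _).1 hz)
  choose c hc using hex
  simp only [hπ] at hc ⊢
  refine ⟨MonoidHom.mk' c fun γ γ' => hinj ?_, hc⟩
  change π (s _) = π (s _)
  rw [hc, map_mul s, map_mul π, map_mul π, hc, hc, hmul]

namespace NormalEmbedding

section IntertwinerGroup

variable {k N G W : Type*} [Field k] [Group N] [Group G] [AddCommGroup W] [Module k W]
  (i : NormalEmbedding N G) (ρ : Representation k N W)

/-- The group of pairs of a group element and an intertwiner realizing its action on `ρ`. -/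
def intertwinerGroup : Subgroup (G × (W ≃ₗ[k] W)) where
  carrier := {γ | ∀ n w, γ.2 (ρ n w) = ρ (i.conj γ.1 n) (γ.2 w)}
  one_mem' := by simp
  mul_mem' {a b} ha hb n w := by
    change a.2 (b.2 _) = _
    rw [hb, ha, Prod.fst_mul, map_mul]
    rfl
  inv_mem' {a} ha n w := a.2.injective (by
    change a.2 (a.2.symm _) = a.2 (ρ _ (a.2.symm w))
    rw [ha]
    simp)

/-- The projection from the group of intertwiners to the ambient group. -/
def intertwinerFst : i.intertwinerGroup ρ →* G :=
  (MonoidHom.fst G (W ≃ₗ[k] W)).comp (i.intertwinerGroup ρ).subtype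

/-- The intertwiner underlying an element of the group of intertwiners. -/
def intertwinerSnd : i.intertwinerGroup ρ →* (W ≃ₗ[k] W) :=
  (MonoidHom.snd G (W ≃ₗ[k] W)).comp (i.intertwinerGroup ρ).subtype

theorem intertwiner_ext {γ γ' : i.intertwinerGroup ρ}
    (h₁ : i.intertwinerFst ρ γ = i.intertwinerFst ρ γ')
    (h₂ : ∀ w, i.intertwinerSnd ρ γ w = i.intertwinerSnd ρ γ' w) : γ = γ' :=
  Subtype.ext (Prod.ext h₁ (LinearEquiv.ext h₂))

theorem intertwinerSnd_rho (γ : i.intertwinerGroup ρ) (n : N) (w : W) :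
    i.intertwinerSnd ρ γ (ρ n w) =
      ρ (i.conj (i.intertwinerFst ρ γ) n) (i.intertwinerSnd ρ γ w) := γ.2 n w

/-- The canonical copy of the normal subgroup in the group of intertwiners. -/
def intertwinerOfRep : N →* i.intertwinerGroup ρ :=
  (i.hom.prod ((LinearMap.GeneralLinearGroup.generalLinearEquiv k W).toMonoidHom.comp
    ρ.toHomUnits)).codRestrict _ fun m n w => by
      change ρ m (ρ n w) = ρ (i.conj (i.hom m) n) (ρ m w)
      rw [conj_hom, ← Module.End.mul_apply, ← Module.End.mul_apply, ← map_mul, ← map_mul,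
        inv_mul_cancel_right]

@[simp] theorem intertwinerFst_ofRep (n : N) :
    i.intertwinerFst ρ (i.intertwinerOfRep ρ n) = i.hom n := rfl

@[simp] theorem intertwinerSnd_ofRep (n : N) (w : W) :
    i.intertwinerSnd ρ (i.intertwinerOfRep ρ n) w = ρ n w := rfl

/-- The scalars in the group of intertwiners. -/
def intertwinerOfScalar : kˣ →* i.intertwinerGroup ρ :=
  ((1 : kˣ →* G).prod (DistribMulAction.toModuleAut k W)).codRestrict _ fun c n w => by
    change (c : k) • ρ n w = ρ (i.conj 1 n) ((c : k) • w)
    simp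

@[simp] theorem intertwinerFst_ofScalar (c : kˣ) :
    i.intertwinerFst ρ (i.intertwinerOfScalar ρ c) = 1 := rfl

@[simp] theorem intertwinerSnd_ofScalar (c : kˣ) (w : W) :
    i.intertwinerSnd ρ (i.intertwinerOfScalar ρ c) w = (c : k) • w := rfl

theorem intertwinerOfScalar_mul_comm (c : kˣ) (γ : i.intertwinerGroup ρ) :
    i.intertwinerOfScalar ρ c * γ = γ * i.intertwinerOfScalar ρ c := by
  refine i.intertwiner_ext ρ (by simp) fun w => ?_
  simp

theorem range_intertwinerOfRep_normal : (i.intertwinerOfRep ρ).range.Normal := by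
  refine ⟨?_⟩
  rintro _ ⟨n, rfl⟩ γ
  refine ⟨i.conj (i.intertwinerFst ρ γ) n, ?_⟩
  rw [eq_mul_inv_iff_mul_eq]
  refine i.intertwiner_ext ρ ?_ fun w => ?_
  · simp [i.hom_conj]
  · simp [intertwinerSnd_rho]

theorem eq_one_of_intertwinerOfScalar_mem_range [Nontrivial W] (c : kˣ)
    (hc : i.intertwinerOfScalar ρ c ∈ (i.intertwinerOfRep ρ).range) : c = 1 := by
  obtain ⟨n, hn⟩ := hc
  have h1 : i.hom n = 1 := congrArg (i.intertwinerFst ρ) hn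
  rw [i.injective (h1.trans (map_one i.hom).symm), map_one] at hn
  obtain ⟨w, hw⟩ := exists_ne (0 : W)
  have h2 : w = (c : k) • w := congrArg (fun γ => i.intertwinerSnd ρ γ w) hn
  refine Units.ext (smul_left_injective k hw ?_)
  change (c : k) • w = (1 : k) • w
  rw [← h2, one_smul]

variable {ρ}

theorem intertwinerFst_surjective (hinv : i.inertia ρ = ⊤) :
    Function.Surjective (i.intertwinerFst ρ) := fun g => by
  obtain ⟨X, hX⟩ := (i.mem_inertia ρ).1 (hinv ▸ Subgroup.mem_top g)
  exact ⟨⟨(g, X), hX⟩, rfl⟩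

variable [IsAlgClosed k] [FiniteDimensional k W]

theorem exists_eq_intertwinerOfScalar (hρ : ρ.IsIrreducible) {γ : i.intertwinerGroup ρ}
    (hγ : i.intertwinerFst ρ γ = 1) : ∃ c, γ = i.intertwinerOfScalar ρ c := by
  have := hρ.nontrivial
  obtain ⟨c, hc⟩ := hρ.exists_eq_smul (i.intertwinerSnd ρ γ).toLinearMap fun n w => by
    simp [intertwinerSnd_rho, hγ]
  have hc0 : c ≠ 0 := by
    rintro rfl
    obtain ⟨w, hw⟩ := exists_ne (0 : W)
    refine hw ((i.intertwinerSnd ρ γ).injective ?_)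
    rw [map_zero]
    exact (hc w).trans (zero_smul k w)
  exact ⟨Units.mk0 c hc0, i.intertwiner_ext ρ hγ hc⟩

theorem range_sup_range_intertwiner (hρ : ρ.IsIrreducible) :
    (i.intertwinerOfRep ρ).range ⊔ (i.intertwinerOfScalar ρ).range =
      i.hom.range.comap (i.intertwinerFst ρ) := by
  refine le_antisymm (sup_le ?_ ?_) ?_
  · rintro _ ⟨n, rfl⟩
    exact ⟨n, rfl⟩
  · rintro _ ⟨c, rfl⟩
    exact ⟨1, map_one i.hom⟩
  · rintro γ ⟨n, hn⟩
    obtain ⟨c, hc⟩ := i.exists_eq_intertwinerOfScalar hρ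
      (γ := (i.intertwinerOfRep ρ n)⁻¹ * γ) (by simp [hn])
    rw [inv_mul_eq_iff_eq_mul] at hc
    rw [hc]
    exact Subgroup.mul_mem_sup ⟨n, rfl⟩ ⟨c, rfl⟩

/-- The power map on the group of intertwiners is, modulo the normal subgroup, a homomorphism
to the scalars. -/
theorem exists_intertwiner_pow_hom (hρ : ρ.IsIrreducible) (hinv : i.inertia ρ = ⊤)
    (hk : i.hom.range.index ≠ 0) :
    ∃ c : i.intertwinerGroup ρ →* kˣ,
      (∀ γ, ∃ n, γ ^ i.hom.range.index =
        i.intertwinerOfRep ρ n * i.intertwinerOfScalar ρ (c γ)) ∧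
      (∀ n, c (i.intertwinerOfRep ρ n) = 1) ∧
      ∀ z, c (i.intertwinerOfScalar ρ z) = z ^ i.hom.range.index := by
  have := hρ.nontrivial
  have hidx : ((i.intertwinerOfRep ρ).range ⊔ (i.intertwinerOfScalar ρ).range).index =
      i.hom.range.index := by
    rw [i.range_sup_range_intertwiner hρ,
      Subgroup.index_comap_of_surjective _ (i.intertwinerFst_surjective hinv)]
  obtain ⟨c, hc⟩ := exists_monoidHom_pow_index (i.intertwinerOfRep ρ) (i.intertwinerOfScalar ρ)
    (i.range_intertwinerOfRep_normal ρ) (i.intertwinerOfScalar_mul_comm ρ)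
    (i.eq_one_of_intertwinerOfScalar_mem_range ρ) (hidx ▸ hk)
  rw [hidx] at hc
  refine ⟨c, fun γ => ?_, fun n => ?_, fun z => ?_⟩
  · obtain ⟨n, hn⟩ := hc γ
    exact ⟨n, by rw [hn, inv_mul_cancel_right]⟩
  · refine i.eq_one_of_intertwinerOfScalar_mem_range ρ _ ?_
    have := hc (i.intertwinerOfRep ρ n)
    rwa [← map_pow, Subgroup.mul_mem_cancel_left (i.intertwinerOfRep ρ).range ⟨_, rfl⟩,
      inv_mem_iff] at this
  · have := hc (i.intertwinerOfScalar ρ z)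
    rw [← map_pow, ← map_inv, ← map_mul] at this
    exact (mul_inv_eq_one.1 (i.eq_one_of_intertwinerOfScalar_mem_range ρ _ this)).symm

/-- A homomorphism from the group of intertwiners to the scalars that is the identity on
scalars and trivial on the normal subgroup provides an extension of the representation. -/
theorem exists_extension (hρ : ρ.IsIrreducible) (hinv : i.inertia ρ = ⊤)
    (θ : i.intertwinerGroup ρ →* kˣ) (hθN : ∀ n, θ (i.intertwinerOfRep ρ n) = 1)
    (hθ : ∀ z, θ (i.intertwinerOfScalar ρ z) = z) :
    ∃ τ : Representation k G W, (∀ n, τ (i.hom n) = ρ n) ∧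
      ∀ γ w, i.intertwinerSnd ρ γ w = (θ γ : k) • τ (i.intertwinerFst ρ γ) w := by
  let τ' : i.intertwinerGroup ρ →* (W ≃ₗ[k] W) :=
    { toFun := fun γ => i.intertwinerSnd ρ (i.intertwinerOfScalar ρ (θ γ)⁻¹ * γ)
      map_one' := by simp
      map_mul' := fun a b => by
        rw [← map_mul]
        congr 1
        rw [map_mul, mul_inv, map_mul]
        exact Commute.mul_mul_mul_comm (i.intertwinerOfScalar_mul_comm ρ _ _) _ _ }
  have hτ' : ∀ γ w, τ' γ w = ((θ γ)⁻¹ : kˣ) • i.intertwinerSnd ρ γ w := fun γ w => by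
    change i.intertwinerSnd ρ (i.intertwinerOfScalar ρ (θ γ)⁻¹ * γ) w = _
    rw [map_mul]
    rfl
  have hker : (i.intertwinerFst ρ).ker ≤ τ'.ker := fun γ hγ => by
    obtain ⟨c, rfl⟩ := i.exists_eq_intertwinerOfScalar hρ hγ
    rw [MonoidHom.mem_ker]
    ext w
    rw [hτ', hθ, intertwinerSnd_ofScalar, ← Units.smul_def, inv_smul_smul]
    rfl
  let τ'' : G →* (W ≃ₗ[k] W) :=
    (i.intertwinerFst ρ).liftOfSurjective (i.intertwinerFst_surjective hinv) ⟨τ', hker⟩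
  have hτ'' : ∀ γ, τ'' (i.intertwinerFst ρ γ) = τ' γ := fun γ =>
    MonoidHom.liftOfRightInverse_comp_apply _ _ _ ⟨τ', hker⟩ γ
  refine ⟨{ toFun := fun g => (τ'' g).toLinearMap, map_one' := ?_, map_mul' := ?_ }, ?_, ?_⟩
  · rw [map_one]; rfl
  · intro a b
    rw [map_mul]; rfl
  · intro n
    refine LinearMap.ext fun w => ?_
    change τ'' (i.intertwinerFst ρ (i.intertwinerOfRep ρ n)) w = _
    rw [hτ'', hτ', hθN, inv_one, one_smul, intertwinerSnd_ofRep]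
  · intro γ w
    change _ = (θ γ : k) • τ'' (i.intertwinerFst ρ γ) w
    rw [hτ'', hτ', ← Units.smul_def, smul_inv_smul]

end IntertwinerGroup

end NormalEmbedding

namespace Representation

section

variable {p : ℕ} {N G W : Type*} [Group N] [Finite N] [Group G]
  [AddCommGroup W] [Module ℂ W] [FiniteDimensional ℂ W] (i : NormalEmbedding N G)
  {ρ : Representation ℂ N W}

theorem IsPRational.mem_adjoin_of_extension (hρ : ρ.IsPRational p) {P : Subgroup N}
    (hP : IsPGroup p P) (hR : ∀ n, ρ n ∈ Algebra.adjoin (Qfield p) (ρ '' P))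
    {τ : Representation ℂ G W} (hτ : ∀ n, τ (i.hom n) = ρ n) {g : G} {k : ℕ}
    (h : ∀ X : W ≃ₗ[ℂ] W, (∀ n w, X (ρ n w) = ρ (i.conj g n) (X w)) →
      ∃ (n : N) (c : ℂ) (u v : ℤ), X.toLinearMap ^ k = c • ρ n ∧
        X.toLinearMap = (c ^ u * (LinearMap.det X.toLinearMap ^ Module.finrank ℂ W) ^ v) • τ g) :
    τ g ∈ Algebra.adjoin (Qfield p) (ρ '' P) := by
  have := Fintype.ofFinite N
  have := hρ.irreducible.nontrivial
  set R := Algebra.adjoin (Qfield p) (ρ '' P)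
  have hconj : ∀ n, ρ (i.conj g n) * τ g = τ g * ρ n := fun n => by
    rw [← hτ, ← hτ, ← map_mul, ← map_mul, i.mul_hom]
  have hinv : τ g⁻¹ * τ g = 1 := by rw [← map_mul, inv_mul_cancel, map_one]
  have hinv' : τ g * τ g⁻¹ = 1 := by rw [← map_mul, mul_inv_cancel, map_one]
  let Ψ : Module.End ℂ W →ₗ[ℂ] Module.End ℂ W :=
    ∑ x : N, LinearMap.mulLeft ℂ (ρ (i.conj g x)) ∘ₗ LinearMap.mulRight ℂ (ρ x⁻¹)
  have hΨ : ∀ a, Ψ a = ∑ x : N, ρ (i.conj g x) * (a * ρ x⁻¹) := fun a => by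
    simp [Ψ, LinearMap.sum_apply]
  obtain ⟨y, hy⟩ : ∃ y, Ψ (ρ y) ≠ 0 := by
    by_contra! hcon
    have h0 : Ψ = 0 := LinearMap.ext_on hρ.irreducible.span_range_eq_top (by
      rintro _ ⟨y, rfl⟩
      exact hcon y)
    have h1 := hΨ (τ g)
    have h2 : ∀ x, ρ (i.conj g x) * (τ g * ρ x⁻¹) = τ g := fun x => by
      rw [← mul_assoc, hconj, mul_assoc, ← map_mul, mul_inv_cancel, map_one, mul_one]
    rw [h0, Finset.sum_congr rfl fun x _ => h2 x, Finset.sum_const, LinearMap.zero_apply,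
      ← Nat.cast_smul_eq_nsmul ℂ] at h1
    have h3 := (smul_eq_zero.1 h1.symm).resolve_left
      (Nat.cast_ne_zero.2 (Finset.card_ne_zero.2 Finset.univ_nonempty))
    rw [h3, mul_zero] at hinv
    exact zero_ne_one hinv
  set r := Ψ (ρ y) with hr
  have hrR : r ∈ R := by
    rw [hr, hΨ]
    exact sum_mem fun x _ => mul_mem (hR _) (mul_mem (hR _) (hR _))
  have hrn : ∀ n, r * ρ n = ρ (i.conj g n) * r := fun n => by
    rw [hr, hΨ, Finset.sum_mul, Finset.mul_sum]
    refine (Fintype.sum_equiv (Equiv.mulLeft n) _ _ fun x => ?_).symm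
    rw [Equiv.coe_mulLeft, map_mul, map_mul, mul_inv_rev, map_mul]
    simp only [mul_assoc]
    rw [← map_mul ρ n⁻¹, inv_mul_cancel, map_one, mul_one]
  obtain ⟨c, hc⟩ := hρ.irreducible.exists_eq_smul (τ g⁻¹ * r) fun n w => by
    rw [← Module.End.mul_apply, ← Module.End.mul_apply, mul_assoc, hrn, ← mul_assoc, ← mul_assoc]
    congr 2
    calc τ g⁻¹ * ρ (i.conj g n) = τ g⁻¹ * (ρ (i.conj g n) * τ g) * τ g⁻¹ := by
          rw [mul_assoc, mul_assoc, hinv', mul_one]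
      _ = ρ n * τ g⁻¹ := by rw [hconj, ← mul_assoc, hinv, one_mul]
  have hrc : r = c • τ g := by
    have h1 : τ g⁻¹ * r = c • 1 := LinearMap.ext hc
    rw [← one_mul r, ← hinv', mul_assoc, h1, mul_smul_comm, mul_one]
  have hc0 : c ≠ 0 := by
    rintro rfl
    exact hy (hrc.trans (zero_smul ℂ _))
  let X : W ≃ₗ[ℂ] W := LinearEquiv.ofLinearMap r (c⁻¹ • τ g⁻¹)
    (by
      change r * c⁻¹ • τ g⁻¹ = 1
      rw [hrc, smul_mul_smul_comm, hinv', mul_inv_cancel₀ hc0, one_smul])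
    (by
      change c⁻¹ • τ g⁻¹ * r = 1
      rw [hrc, smul_mul_smul_comm, hinv, inv_mul_cancel₀ hc0, one_smul])
  obtain ⟨n, d, u, v, hd, hX⟩ := h X fun n w => LinearMap.congr_fun (hrn n) w
  have hXr : X.toLinearMap = r := rfl
  rw [hXr] at hd hX
  have hdF : d ∈ Qfield p := by
    have h1 : d • (1 : Module.End ℂ W) = r ^ k * ρ n⁻¹ := by
      rw [hd, smul_mul_assoc, ← map_mul, mul_inv_cancel, map_one]
    have h2 : d • (1 : Module.End ℂ W) ∈ R := h1 ▸ mul_mem (pow_mem hrR k) (hR _)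
    have h3 := trace_mem_Qfield_of_mem_adjoin ρ hP h2
    rw [map_smul, LinearMap.trace_one, smul_eq_mul] at h3
    have h4 : (Module.finrank ℂ W : ℂ) ≠ 0 := Nat.cast_ne_zero.2 Module.finrank_pos.ne'
    rw [← mul_div_cancel_right₀ d h4]
    exact div_mem h3 (natCast_mem _ _)
  have hspan : Submodule.span ℂ (R : Set (Module.End ℂ W)) = ⊤ := by
    rw [eq_top_iff, ← hρ.irreducible.span_range_eq_top]
    refine Submodule.span_mono ?_
    rintro _ ⟨y, rfl⟩
    exact hR y
  have hdet := det_pow_finrank_mem R hspan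
    (fun x hx => trace_mem_Qfield_of_mem_adjoin ρ hP hx) hrR
  set s := d ^ u * (LinearMap.det r ^ Module.finrank ℂ W) ^ v
  have hs : s ∈ Qfield p := mul_mem (zpow_mem hdF u) (zpow_mem hdet v)
  have hs0 : s ≠ 0 := fun h0 => hy (by rw [hX, h0, zero_smul])
  have hτs : τ g = (⟨s⁻¹, inv_mem hs⟩ : Qfield p) • r := by
    change _ = s⁻¹ • r
    rw [hX, smul_smul, inv_mul_cancel₀ hs0, one_smul]
  rw [hτs]
  exact R.smul_mem hrR _

variable [Fact p.Prime]

/-- A `p`-rational representation invariant under an overgroup of index prime to `p` extends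
to it with determinant of `p`-power order. The last clause computes the scalar by which an
arbitrary intertwiner differs from the extension. -/
theorem IsPRational.exists_extension (hρ : ρ.IsPRational p) (hinv : i.inertia ρ = ⊤)
    (hk : i.hom.range.index.Coprime p) :
    ∃ τ : Representation ℂ G W, (∀ n, τ (i.hom n) = ρ n) ∧
      (∀ g, ∃ a : ℕ, LinearMap.det (τ g) ^ p ^ a = 1) ∧
      ∀ (g : G) (X : W ≃ₗ[ℂ] W), (∀ n w, X (ρ n w) = ρ (i.conj g n) (X w)) →
        ∃ (n : N) (c : ℂ) (u v : ℤ), X.toLinearMap ^ i.hom.range.index = c • ρ n ∧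
          X.toLinearMap =
            (c ^ u * (LinearMap.det X.toLinearMap ^ Module.finrank ℂ W) ^ v) • τ g := by
  have := Fintype.ofFinite N
  have hk0 : i.hom.range.index ≠ 0 := fun h => by
    rw [h, Nat.coprime_zero_left] at hk
    exact (Fact.out : p.Prime).ne_one hk
  set k := i.hom.range.index with hkdef
  obtain ⟨a, ha⟩ := hρ.exists_finrank_eq
  choose b hb using hρ.det_pow
  let q := p ^ ∑ n, b n
  have hq : ∀ n, LinearMap.det (ρ n) ^ q = 1 := fun n => by
    obtain ⟨m, hm⟩ := pow_dvd_pow p (Finset.single_le_sum (fun _ _ => Nat.zero_le _)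
      (Finset.mem_univ n) : b n ≤ ∑ n, b n)
    change _ ^ p ^ _ = _
    rw [hm, pow_mul, hb, one_pow]
  obtain ⟨c, hc, hcN, hcS⟩ := i.exists_intertwiner_pow_hom hρ.irreducible hinv hk0
  let d : i.intertwinerGroup ρ →* ℂˣ := LinearEquiv.det.comp (i.intertwinerSnd ρ)
  have hd : ∀ γ, (d γ : ℂ) = LinearMap.det (i.intertwinerSnd ρ γ).toLinearMap := fun γ =>
    LinearEquiv.coe_det _
  let δ : i.intertwinerGroup ρ →* ℂˣ := (powMonoidHom (p ^ a * q)).comp d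
  have hδ : ∀ γ, δ γ = d γ ^ (p ^ a * q) := fun _ => rfl
  have hδN : ∀ n, δ (i.intertwinerOfRep ρ n) = 1 := fun n => by
    rw [hδ]
    refine Units.ext ?_
    rw [Units.val_pow_eq_pow_val, hd, mul_comm, pow_mul,
      show (i.intertwinerSnd ρ (i.intertwinerOfRep ρ n)).toLinearMap = ρ n from rfl, hq, one_pow,
      Units.val_one]
  have hδS : ∀ z, δ (i.intertwinerOfScalar ρ z) = z ^ (p ^ a * (p ^ a * q)) := fun z => by
    have h : d (i.intertwinerOfScalar ρ z) = z ^ p ^ a := Units.ext (by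
      rw [hd, show (i.intertwinerSnd ρ (i.intertwinerOfScalar ρ z)).toLinearMap =
        (z : ℂ) • (LinearMap.id : W →ₗ[ℂ] W) from rfl, LinearMap.det_smul, LinearMap.det_id,
        mul_one, ha, Units.val_pow_eq_pow_val])
    rw [hδ, h, ← pow_mul]
  obtain ⟨u, v, huv⟩ : IsCoprime (k : ℤ) ((p ^ a * (p ^ a * q) : ℕ) : ℤ) :=
    Nat.isCoprime_iff_coprime.2 ((hk.pow_right a).mul_right
      ((hk.pow_right a).mul_right (hk.pow_right _)))
  let θ : i.intertwinerGroup ρ →* ℂˣ := (zpowGroupHom u).comp c * (zpowGroupHom v).comp δ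
  have hθ : ∀ γ, θ γ = c γ ^ u * δ γ ^ v := fun _ => rfl
  have hθN : ∀ n, θ (i.intertwinerOfRep ρ n) = 1 := fun n => by
    rw [hθ, hcN, hδN, one_zpow, one_zpow, one_mul]
  have hθS : ∀ z, θ (i.intertwinerOfScalar ρ z) = z := fun z => by
    rw [hθ, hcS, hδS, ← zpow_natCast, ← zpow_natCast, ← zpow_mul, ← zpow_mul, ← zpow_add,
      mul_comm _ u, mul_comm _ v, huv, zpow_one]
  obtain ⟨τ, hτ, hτθ⟩ := i.exists_extension hρ.irreducible hinv θ hθN hθS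
  refine ⟨τ, hτ, fun g => ⟨a + ∑ n, b n, ?_⟩, fun g X hX => ?_⟩
  · obtain ⟨γ₀, rfl⟩ := i.intertwinerFst_surjective hinv g
    let γ := γ₀ * i.intertwinerOfScalar ρ (θ γ₀)⁻¹
    have h1 : θ γ = 1 := by rw [map_mul, hθS, mul_inv_cancel]
    have h2 : i.intertwinerFst ρ γ = i.intertwinerFst ρ γ₀ := by
      rw [map_mul, NormalEmbedding.intertwinerFst_ofScalar, mul_one]
    obtain ⟨n, hn⟩ := hc γ
    have h3 : c γ = 1 := by
      have := congrArg θ hn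
      rwa [map_pow, h1, one_pow, map_mul, hθN, hθS, one_mul, eq_comm] at this
    have h4 : δ γ ^ k = 1 := by
      rw [← map_pow, hn, h3, map_one, mul_one, hδN]
    have h5 : δ γ ^ v = 1 := by
      rwa [hθ, h3, one_zpow, one_mul] at h1
    have h6 : δ γ = 1 := by
      rw [← zpow_one (δ γ), ← huv, zpow_add, mul_comm u, zpow_mul, zpow_mul, zpow_natCast, h4, h5,
        one_zpow, one_zpow, one_mul]
    have h7 : (i.intertwinerSnd ρ γ).toLinearMap = τ (i.intertwinerFst ρ γ₀) := by
      ext w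
      rw [LinearEquiv.coe_coe, hτθ, h1, h2, Units.val_one, one_smul]
    rw [← h7, pow_add]
    have h8 := congrArg Units.val h6
    rwa [hδ, Units.val_pow_eq_pow_val, hd] at h8
  · let γ : i.intertwinerGroup ρ := ⟨(g, X), hX⟩
    obtain ⟨n, hn⟩ := hc γ
    refine ⟨n, c γ, u, (q : ℤ) * v, ?_, ?_⟩
    · ext w
      have h1 : i.intertwinerSnd ρ (γ ^ k) = X ^ k := map_pow _ _ _
      have h2 : (X.toLinearMap ^ k) w = (X ^ k) w := by
        rw [Module.End.pow_apply, LinearEquiv.pow_apply]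
        rfl
      rw [h2, ← h1, hn, map_mul]
      exact map_smul (ρ n) (c γ : ℂ) w
    · ext w
      refine (hτθ γ w).trans ?_
      rw [hθ, hδ]
      simp only [Units.val_mul, Units.val_zpow_eq_zpow_val, Units.val_pow_eq_pow_val]
      rw [hd, ha, zpow_mul, zpow_natCast, ← pow_mul]
      rfl


/-- A `p`-rational representation invariant under an overgroup of index prime to `p` has a
`p`-rational extension. -/
theorem IsPRational.exists_isPRational_extension (hρ : ρ.IsPRational p)
    (hinv : i.inertia ρ = ⊤) (hk : i.hom.range.index.Coprime p) :
    ∃ τ : Representation ℂ G W, (∀ n, τ (i.hom n) = ρ n) ∧ τ.IsPRational p := by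
  obtain ⟨τ, hτ, hdet, h⟩ := hρ.exists_extension i hinv hk
  obtain ⟨P, hP, hidx, hR⟩ := hρ.exists_subgroup
  refine ⟨τ, hτ, hρ.irreducible.of_forall_exists fun n => ⟨i.hom n, hτ n⟩,
    ⟨P.map i.hom, hP.map _, ?_, fun g => ?_⟩, hdet⟩
  · rw [Subgroup.index_map_of_injective P i.injective, (Fact.out : p.Prime).dvd_mul]
    rintro (h1 | h1)
    · exact hidx h1
    · exact (Fact.out : p.Prime).ne_one (Nat.eq_one_of_dvd_coprimes hk h1 dvd_rfl)
  · have himage : τ '' (P.map i.hom : Subgroup G) = ρ '' P := by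
      rw [Subgroup.coe_map, Set.image_image]
      exact Set.image_congr fun n _ => hτ n
    rw [himage]
    exact hρ.mem_adjoin_of_extension i hP hR hτ (h g)

end

end Representation

/-- The cardinalities allowed for the factors of a `p`-solvable series. -/
def IsPFactor (p m : ℕ) : Prop := (∃ k : ℕ, m = p ^ k) ∨ m.Coprime p

theorem IsPFactor.of_dvd {p m d : ℕ} (hp : p.Prime) (h : IsPFactor p m) (hd : d ∣ m) :
    IsPFactor p d := by
  rcases h with ⟨k, rfl⟩ | h
  · obtain ⟨j, -, hj⟩ := (Nat.dvd_prime_pow hp).1 hd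
    exact Or.inl ⟨j, hj⟩
  · exact Or.inr (h.coprime_dvd_left hd)

/-- An ascending series of subgroups starting at the trivial subgroup, whose first `n` factors
are `p`-groups or `p'`-groups. -/
structure IsPSeries {G : Type*} [Group G] (p n : ℕ) (H : ℕ → Subgroup G) : Prop where
  zero : H 0 = ⊥
  le : ∀ i, i < n → H i ≤ H (i + 1)
  normal : ∀ i, i < n → ((H i).subgroupOf (H (i + 1))).Normal
  isPFactor : ∀ i, i < n → IsPFactor p ((H i).relIndex (H (i + 1)))

theorem isPSolvable_iff {p : ℕ} {G : Type} [Group G] :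
    IsPSolvable p G ↔ ∃ (n : ℕ) (H : ℕ → Subgroup G), IsPSeries p n H ∧ H n = ⊤ :=
  exists₂_congr fun _ _ =>
    ⟨fun ⟨h0, hn, h1, h2, h3⟩ => ⟨⟨h0, h1, h2, h3⟩, hn⟩,
      fun ⟨⟨h0, h1, h2, h3⟩, hn⟩ => ⟨h0, hn, h1, h2, h3⟩⟩

namespace IsPSeries

variable {p n : ℕ} {G : Type*} [Group G] {H : ℕ → Subgroup G}

theorem of_le (h : IsPSeries p n H) {m : ℕ} (hm : m ≤ n) : IsPSeries p m H :=
  ⟨h.zero, fun i hi => h.le i (hi.trans_le hm), fun i hi => h.normal i (hi.trans_le hm),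
    fun i hi => h.isPFactor i (hi.trans_le hm)⟩

theorem subgroupOf (hp : p.Prime) (h : IsPSeries p n H) (T : Subgroup G) :
    IsPSeries p n fun i => (H i).subgroupOf T where
  zero := by rw [h.zero, Subgroup.bot_subgroupOf]
  le i hi := Subgroup.comap_mono (h.le i hi)
  normal i hi := by
    refine (Subgroup.normal_subgroupOf_iff (Subgroup.comap_mono (h.le i hi))).2 ?_
    exact fun a b ha hb =>
      (Subgroup.normal_subgroupOf_iff (h.le i hi)).1 (h.normal i hi) a b ha hb
  isPFactor i hi := by
    refine (h.isPFactor i hi).of_dvd hp ?_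
    have := h.normal i hi
    change ((H i).comap T.subtype).relIndex _ ∣ _
    rw [Subgroup.relIndex_comap, Subgroup.subgroupOf_map_subtype,
      ← Subgroup.relIndex_subgroupOf inf_le_left]
    exact Subgroup.relIndex_dvd_index_of_normal _ _

theorem map (hp : p.Prime) (h : IsPSeries p n H) {K : Type*} [Group K] (f : G →* K) :
    IsPSeries p n fun i => (H i).map f where
  zero := by rw [h.zero, Subgroup.map_bot]
  le i hi := Subgroup.map_mono (h.le i hi)
  normal i hi := by
    rw [Subgroup.normal_subgroupOf_iff (Subgroup.map_mono (h.le i hi))]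
    rintro _ _ ⟨a, ha, rfl⟩ ⟨b, hb, rfl⟩
    exact ⟨b * a * b⁻¹, (Subgroup.normal_subgroupOf_iff (h.le i hi)).1 (h.normal i hi) a b ha hb,
      by simp⟩
  isPFactor i hi := by
    refine (h.isPFactor i hi).of_dvd hp ?_
    rw [← Subgroup.relIndex_comap]
    exact Subgroup.relIndex_dvd_of_le_left _ (Subgroup.le_comap_map f (H i))

end IsPSeries

theorem IsPSolvable.subgroup {p : ℕ} (hp : p.Prime) {G : Type} [Group G] (h : IsPSolvable p G)
    (T : Subgroup G) : IsPSolvable p T := by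
  obtain ⟨n, H, hH, hn⟩ := isPSolvable_iff.1 h
  exact isPSolvable_iff.2 ⟨n, _, hH.subgroupOf hp T, by rw [hn, Subgroup.top_subgroupOf]⟩

namespace Subgroup

theorem card_sup_dvd {G : Type*} [Group G] (H K : Subgroup G) [K.Normal] :
    Nat.card (H ⊔ K : Subgroup G) ∣ Nat.card H * Nat.card K := by
  rw [← relIndex_bot_left, ← relIndex_mul_relIndex ⊥ K (H ⊔ K) bot_le le_sup_right,
    relIndex_sup_right, relIndex_bot_left, mul_comm]
  exact Nat.mul_dvd_mul_right (relIndex_dvd_card _ _) _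

/-- For a class of cardinalities closed under divisors and products, a largest normal subgroup
with cardinality in the class is characteristic. -/
theorem exists_characteristic {G : Type*} [Group G] [Finite G] {t : ℕ → Prop}
    (hdvd : ∀ {a b}, a ∣ b → t b → t a) (hmul : ∀ {a b}, t a → t b → t (a * b))
    {K : Subgroup G} (hK : K.Normal) (hK0 : K ≠ ⊥) (ht : t (Nat.card K)) :
    ∃ L : Subgroup G, L.Characteristic ∧ L ≠ ⊥ ∧ t (Nat.card L) := by
  obtain ⟨L, ⟨hL, hL0, hLt⟩, hmax⟩ := Set.Finite.exists_maximal
    (Set.toFinite {L : Subgroup G | L.Normal ∧ L ≠ ⊥ ∧ t (Nat.card L)}) ⟨K, hK, hK0, ht⟩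
  refine ⟨L, characteristic_iff_map_le.2 fun φ => ?_, hL0, hLt⟩
  have hφ : (L.map φ.toMonoidHom).Normal := hL.map _ φ.surjective
  have hcard : Nat.card (L.map φ.toMonoidHom) = Nat.card L :=
    card_map_of_injective φ.injective
  exact le_sup_right.trans (hmax ⟨sup_normal _ _, fun h => hL0 (le_bot_iff.1 (h ▸ le_sup_left)),
    hdvd (card_sup_dvd _ _) (hmul hLt (hcard ▸ hLt))⟩ le_sup_left)

end Subgroup

theorem IsPFactor.exists_characteristic {p : ℕ} (hp : p.Prime) {G : Type*} [Group G] [Finite G]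
    {K : Subgroup G} (hK : K.Normal) (hK0 : K ≠ ⊥) (h : IsPFactor p (Nat.card K)) :
    ∃ L : Subgroup G, L.Characteristic ∧ L ≠ ⊥ ∧ IsPFactor p (Nat.card L) := by
  rcases h with h | h
  · obtain ⟨L, hL, hL0, hLt⟩ := Subgroup.exists_characteristic (t := fun m => ∃ k, m = p ^ k)
      (by
        rintro a _ hab ⟨k, rfl⟩
        obtain ⟨j, -, hj⟩ := (Nat.dvd_prime_pow hp).1 hab
        exact ⟨j, hj⟩)
      (by
        rintro _ _ ⟨j, rfl⟩ ⟨k, rfl⟩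
        exact ⟨j + k, (pow_add _ _ _).symm⟩) hK hK0 h
    exact ⟨L, hL, hL0, Or.inl hLt⟩
  · obtain ⟨L, hL, hL0, hLt⟩ := Subgroup.exists_characteristic (t := fun m => m.Coprime p)
      (fun hab h => h.coprime_dvd_left hab) (fun h1 h2 => h1.mul_left h2) hK hK0 h
    exact ⟨L, hL, hL0, Or.inr hLt⟩

theorem IsPSeries.exists_normal {p : ℕ} (hp : p.Prime) {n : ℕ} :
    ∀ {G : Type} [Group G] [Finite G] [Nontrivial G] {H : ℕ → Subgroup G},
      IsPSeries p n H → H n = ⊤ →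
      ∃ K : Subgroup G, K.Normal ∧ K ≠ ⊥ ∧ IsPFactor p (Nat.card K) := by
  induction n with
  | zero =>
    intro G _ _ _ H hH hn
    exact absurd (hH.zero.symm.trans hn) bot_ne_top
  | succ n ih =>
    intro G _ _ _ H hH hn
    by_cases hbot : H n = ⊥
    · refine ⟨⊤, inferInstance, top_ne_bot, ?_⟩
      have := hH.isPFactor n n.lt_succ_self
      rwa [hbot, Subgroup.relIndex_bot_left, hn] at this
    · have hnorm : (H n).Normal :=
        ⟨fun a ha b => (Subgroup.normal_subgroupOf_iff (hH.le n n.lt_succ_self)).1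
          (hH.normal n n.lt_succ_self) a b ha (hn ▸ Subgroup.mem_top b)⟩
      have : Nontrivial (H n) := (Subgroup.nontrivial_iff_ne_bot _).2 hbot
      obtain ⟨K, hK, hK0, hKt⟩ := ih ((hH.of_le n.le_succ).subgroupOf hp (H n))
        (Subgroup.subgroupOf_self _)
      obtain ⟨L, hL, hL0, hLt⟩ := hKt.exists_characteristic hp hK hK0
      refine ⟨L.map (H n).subtype, inferInstance, fun h => hL0 ?_, ?_⟩
      · exact (Subgroup.map_eq_bot_iff_of_injective L (H n).subtype_injective).1 h
      · rwa [Subgroup.card_map_of_injective (H n).subtype_injective]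

/-- Above a proper normal subgroup of a `p`-solvable group there is a larger normal subgroup
with factor a `p`-group or a `p'`-group. -/
theorem IsPSolvable.exists_normal_gt {p : ℕ} (hp : p.Prime) {G : Type} [Group G] [Finite G]
    (h : IsPSolvable p G) {N : Subgroup G} (hN : N.Normal) (hN1 : N ≠ ⊤) :
    ∃ M : Subgroup G, M.Normal ∧ N < M ∧ IsPFactor p (N.relIndex M) := by
  obtain ⟨n, H, hH, hn⟩ := isPSolvable_iff.1 h
  have : Nontrivial (G ⧸ N) := QuotientGroup.nontrivial_iff.2 hN1
  have hsurj := QuotientGroup.mk'_surjective N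
  obtain ⟨K, hK, hK0, hKt⟩ := (hH.map hp (QuotientGroup.mk' N)).exists_normal hp
    (by rw [hn, Subgroup.map_top_of_surjective _ hsurj])
  have hker : (⊥ : Subgroup (G ⧸ N)).comap (QuotientGroup.mk' N) = N :=
    (MonoidHom.comap_bot _).trans (QuotientGroup.ker_mk' N)
  have hidx : N.relIndex (K.comap (QuotientGroup.mk' N)) = Nat.card K :=
    calc N.relIndex (K.comap (QuotientGroup.mk' N)) =
        ((⊥ : Subgroup (G ⧸ N)).comap (QuotientGroup.mk' N)).relIndex
          (K.comap (QuotientGroup.mk' N)) := by rw [hker]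
      _ = Nat.card K := by
        rw [Subgroup.relIndex_comap, Subgroup.map_comap_eq_self_of_surjective hsurj,
          Subgroup.relIndex_bot_left]
  have hle : N ≤ K.comap (QuotientGroup.mk' N) := hker.ge.trans (Subgroup.comap_mono bot_le)
  refine ⟨K.comap (QuotientGroup.mk' N), hK.comap _, hle.lt_of_ne fun h => hK0 ?_, hidx ▸ hKt⟩
  rw [← h, Subgroup.relIndex_self] at hidx
  exact Subgroup.card_eq_one.1 hidx.symm

theorem NormalEmbedding.index_range_restrict {N G : Type*} [Group N] [Group G]
    (i : NormalEmbedding N G) (T : Subgroup G) (hT : i.hom.range ≤ T) :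
    (i.restrict T hT).hom.range.index = i.hom.range.relIndex T := by
  rw [Subgroup.relIndex]
  congr 1
  ext x
  simp [Subgroup.mem_subgroupOf, Subtype.ext_iff]

namespace Representation

variable {p : ℕ} [Fact p.Prime]

theorem IsPRational.exists_of_isPFactor {N G W : Type} [Group N] [Group G] [Finite G]
    [AddCommGroup W] [Module ℂ W] [FiniteDimensional ℂ W] (i : NormalEmbedding N G)
    {ρ : Representation ℂ N W} (hρ : ρ.IsPRational p) (hinv : i.inertia ρ = ⊤)
    (hk : IsPFactor p i.hom.range.index) :
    ∃ (V : Type) (_ : AddCommGroup V) (_ : Module ℂ V) (_ : FiniteDimensional ℂ V)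
      (σ : Representation ℂ G V), σ.IsPRational p ∧
      ∃ f : V →ₗ[ℂ] W, f ≠ 0 ∧ ∀ n v, f (σ (i.hom n) v) = ρ n (f v) := by
  have := Finite.of_injective i.hom i.injective
  have := hρ.irreducible.nontrivial
  rcases hk with ⟨a, ha⟩ | hk
  · obtain ⟨V, _, _, _, σ, hσ, hf⟩ := exists_irreducible_intertwining i ρ
    exact ⟨V, _, _, inferInstance, σ, hρ.of_index_eq_pow i hσ hinv ha hf, hf⟩
  · obtain ⟨τ, hτ, hτp⟩ := hρ.exists_isPRational_extension i hinv hk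
    refine ⟨W, _, _, inferInstance, τ, hτp, LinearMap.id, fun h => ?_, fun n v => ?_⟩
    · obtain ⟨w, hw⟩ := exists_ne (0 : W)
      exact hw (LinearMap.congr_fun h w)
    · rw [hτ]
      rfl

/-- Above a `p`-rational representation of a normal subgroup of a `p`-solvable group there is
an irreducible representation with character values in `Qfield p`. -/
theorem IsPRational.exists_trace_mem {m : ℕ} : ∀ {N G W : Type} [Group N] [Group G] [Finite G]
    [AddCommGroup W] [Module ℂ W] [FiniteDimensional ℂ W] (i : NormalEmbedding N G)
    {ρ : Representation ℂ N W}, IsPSolvable p G → ρ.IsPRational p → i.hom.range.index = m →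
    ∃ (V : Type) (_ : AddCommGroup V) (_ : Module ℂ V) (_ : FiniteDimensional ℂ V)
      (σ : Representation ℂ G V), σ.IsIrreducible ∧
      (∀ g, LinearMap.trace ℂ V (σ g) ∈ Qfield p) ∧
      ∃ f : V →ₗ[ℂ] W, f ≠ 0 ∧ ∀ n v, f (σ (i.hom n) v) = ρ n (f v) := by
  induction m using Nat.strong_induction_on with
  | h m ih =>
  intro N G W _ _ _ _ _ _ i ρ hG hρ hm
  by_cases hT : i.inertia ρ = ⊤
  · by_cases htop : i.hom.range = ⊤
    · obtain ⟨V, _, _, _, σ, hσ, hf⟩ := hρ.exists_of_isPFactor i hT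
        (Or.inl ⟨0, by rw [htop, Subgroup.index_top, pow_zero]⟩)
      exact ⟨V, _, _, inferInstance, σ, hσ.irreducible, hσ.trace_mem, hf⟩
    · obtain ⟨M, hM, hlt, hMp⟩ := hG.exists_normal_gt Fact.out i.range_normal htop
      obtain ⟨V, _, _, _, σ, hσ, f, hf0, hf⟩ := hρ.exists_of_isPFactor (i.restrict M hlt.le)
        (i.inertia_restrict ρ M hlt.le (hT ▸ le_top)) (by
          rwa [i.index_range_restrict])
      have hidx : (NormalEmbedding.ofNormal M).hom.range.index < m := by
        rw [← hm, NormalEmbedding.ofNormal, Subgroup.range_subtype]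
        exact Subgroup.index_strictAnti hlt
      obtain ⟨U, _, _, _, ψ, hψ, htr, f', hf0', hf'⟩ :=
        ih _ hidx (NormalEmbedding.ofNormal M) hG hσ rfl
      refine ⟨U, _, _, inferInstance, ψ, hψ, htr, f ∘ₗ f', fun h => ?_, fun n u => ?_⟩
      · have hsurj := hσ.irreducible.surjective_of_ne_zero
          (ρ := ψ.comp (NormalEmbedding.ofNormal M).hom) hf0' hf'
        refine hf0 (LinearMap.ext fun v => ?_)
        obtain ⟨u, rfl⟩ := hsurj v
        exact LinearMap.congr_fun h u
      · rw [LinearMap.comp_apply, LinearMap.comp_apply, ← hf, ← hf']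
        rfl
  · have hidx : (i.restrict _ (i.range_le_inertia ρ)).hom.range.index < m := by
      rw [i.index_range_restrict, ← hm, ← Subgroup.relIndex_mul_index (i.range_le_inertia ρ)]
      refine lt_mul_of_one_lt_right (Nat.pos_of_ne_zero Subgroup.FiniteIndex.index_ne_zero) ?_
      have h1 : (i.inertia ρ).index ≠ 0 := Subgroup.FiniteIndex.index_ne_zero
      have h2 := mt Subgroup.index_eq_one.1 hT
      omega
    obtain ⟨U, _, _, _, ψ, hψ, htr, hf⟩ :=
      ih _ hidx (i.restrict _ (i.range_le_inertia ρ)) (hG.subgroup Fact.out _) hρ rfl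
    exact ⟨_, _, _, inferInstance, _, isIrreducible_coind i hρ.irreducible hψ hf,
      trace_coind_mem ψ (Qfield p) htr, exists_coind_intertwining ψ i _ hf⟩

end Representation

namespace Representation

open scoped ComplexOrder in
/-- Complex representations of finite groups are unitarizable, so that the character at `g⁻¹` is
the complex conjugate of the character at `g`. -/
theorem star_character {G V : Type*} [Group G] [Finite G] [AddCommGroup V] [Module ℂ V]
    [FiniteDimensional ℂ V] (ρ : Representation ℂ G V) (g : G) :
    star (ρ.character g) = ρ.character g⁻¹ := by
  have := Fintype.ofFinite G
  let b := Module.finBasis ℂ V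
  let A : G → Matrix (Fin (Module.finrank ℂ V)) (Fin (Module.finrank ℂ V)) ℂ :=
    fun x => LinearMap.toMatrix b b (ρ x)
  have hmul : ∀ x y, A (x * y) = A x * A y := fun x y => by
    simp only [A, map_mul]
    exact LinearMap.toMatrix_mul b _ _
  have hone : A 1 = 1 := by
    simp only [A, map_one]
    exact LinearMap.toMatrix_one b
  have hinv : ∀ x, A x * A x⁻¹ = 1 := fun x => by rw [← hmul, mul_inv_cancel, hone]
  have htr : ∀ x, ρ.character x = (A x).trace := fun x => LinearMap.trace_eq_matrix_trace ℂ b (ρ x)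
  let h := ∑ x, (A x).conjTranspose * A x
  have hpos : h.PosDef := by
    refine Matrix.posDef_sum Finset.univ_nonempty fun x _ =>
      Matrix.PosDef.conjTranspose_mul_self (A x) (Matrix.mulVec_injective_of_isUnit ?_)
    exact IsUnit.of_mul_eq_one _ (hinv x)
  have hdet : IsUnit h.det := (Matrix.isUnit_iff_isUnit_det h).1 hpos.isUnit
  have hinvariant : (A g).conjTranspose * h * A g = h := by
    simp only [h, Finset.mul_sum, Finset.sum_mul]
    refine Fintype.sum_equiv (Equiv.mulRight g) _ _ fun x => ?_
    simp only [Equiv.coe_mulRight, hmul, Matrix.conjTranspose_mul, Matrix.mul_assoc]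
  have hconj : (A g).conjTranspose * h = h * A g⁻¹ := by
    calc (A g).conjTranspose * h = (A g).conjTranspose * h * (A g * A g⁻¹) := by
          rw [hinv, Matrix.mul_one]
      _ = h * A g⁻¹ := by rw [← Matrix.mul_assoc, hinvariant]
  rw [htr, htr, ← Matrix.trace_conjTranspose]
  calc (A g).conjTranspose.trace = ((A g).conjTranspose * h * h⁻¹).trace := by
        rw [Matrix.mul_nonsing_inv_cancel_right _ _ hdet]
    _ = (h⁻¹ * (h * A g⁻¹)).trace := by rw [hconj, Matrix.trace_mul_comm]
    _ = (A g⁻¹).trace := by rw [Matrix.nonsing_inv_mul_cancel_left _ _ hdet]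

theorem isIrreducible_of_simple {G : Type} [Group G] [Finite G] (V : FDRep ℂ G)
    (hV : CategoryTheory.Simple V) : IsIrreducible V.ρ := by
  have := Fintype.ofFinite G
  have hcard : (Nat.card G : ℂ) ≠ 0 := Nat.cast_ne_zero.2 Nat.card_pos.ne'
  have := invertibleOfNonzero hcard
  have hrank : Module.finrank ℂ (IntertwiningMap V.ρ V.ρ) = 1 := by
    have h := card_inv_mul_sum_char_mul_char_eq_finrank V.ρ V.ρ
    have h1 : ∑ g, Representation.character V.ρ g * Representation.character V.ρ g⁻¹ = Nat.card G :=
      (FDRep.simple_iff_char_is_norm_one V).1 hV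
    rw [h1, inv_mul_cancel₀ hcard] at h
    exact_mod_cast h.symm
  have hid : IntertwiningMap.id V.ρ ≠ 0 := by
    intro h0
    have : Subsingleton (IntertwiningMap V.ρ V.ρ) := by
      refine subsingleton_of_forall_eq 0 fun f => ?_
      ext v
      have hv := congrArg (fun e : IntertwiningMap V.ρ V.ρ => f (e v)) h0
      simpa using hv
    rw [Module.finrank_zero_of_subsingleton] at hrank
    exact zero_ne_one hrank
  have : Nontrivial V := by
    by_contra hn
    rw [not_nontrivial_iff_subsingleton] at hn
    exact hid (by ext v; exact Subsingleton.elim _ _)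
  refine isIrreducible_of_forall_exists_smul V.ρ fun f hf => ?_
  obtain ⟨c, hc⟩ := (finrank_eq_one_iff_of_nonzero' _ hid).1 hrank
    (f.intertwiningMap_of_isIntertwiningMap V.ρ V.ρ hf)
  refine ⟨c, fun v => ?_⟩
  exact (congrArg (fun e : IntertwiningMap V.ρ V.ρ => e v) hc).symm

theorem IsIrreducible.isIrreducibleCharacter {G V : Type} [Group G] [Finite G] [AddCommGroup V]
    [Module ℂ V] [FiniteDimensional ℂ V] {ρ : Representation ℂ G V} (h : ρ.IsIrreducible) :
    IsIrreducibleCharacter G ρ.character := by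
  have := Fintype.ofFinite G
  have hcard : (Nat.card G : ℂ) ≠ 0 := Nat.cast_ne_zero.2 Nat.card_pos.ne'
  have := invertibleOfNonzero hcard
  refine ⟨FDRep.of ρ, (FDRep.simple_iff_char_is_norm_one _).2 ?_, rfl⟩
  have h1 := char_orthonormal ρ ρ
  rw [if_pos ⟨Equiv.refl ρ⟩, inv_mul_eq_one₀ hcard] at h1
  exact h1.symm

/-- A nonzero intertwining map forces the inner product of the characters to be nonzero. -/
theorem sum_character_mul_star_ne_zero {G V W : Type*} [Group G] [Fintype G] [AddCommGroup V]
    [Module ℂ V] [FiniteDimensional ℂ V] [AddCommGroup W] [Module ℂ W] [FiniteDimensional ℂ W]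
    {σ : Representation ℂ G V} {ρ : Representation ℂ G W} {f : V →ₗ[ℂ] W} (hf : f ≠ 0)
    (h : ∀ g v, f (σ g v) = ρ g (f v)) :
    ∑ g, σ.character g * star (ρ.character g) ≠ 0 := by
  have hcard : (Nat.card G : ℂ) ≠ 0 := Nat.cast_ne_zero.2 Nat.card_pos.ne'
  have := invertibleOfNonzero hcard
  have hsum : ∑ g, σ.character g * star (ρ.character g) =
      ∑ g, ρ.character g * σ.character g⁻¹ :=
    Fintype.sum_equiv (Equiv.inv G) _ _ fun g => by
      rw [star_character, Equiv.inv_apply, inv_inv, mul_comm]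
  have : Nontrivial (IntertwiningMap σ ρ) := by
    refine nontrivial_of_ne (f.intertwiningMap_of_isIntertwiningMap σ ρ h) 0 fun h0 => hf ?_
    exact congrArg IntertwiningMap.toLinearMap h0
  have hrank := card_inv_mul_sum_char_mul_char_eq_finrank σ ρ
  rw [hsum]
  intro h0
  rw [h0, mul_zero] at hrank
  exact Module.finrank_pos.ne' (Nat.cast_eq_zero.1 hrank.symm)

/-- An irreducible representation of a `p`-group is `p`-rational. -/
theorem IsIrreducible.isPRational {p : ℕ} {N W : Type*} [Group N] [AddCommGroup W] [Module ℂ W]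
    (hN : IsPGroup p N) (hp : p ≠ 1) {ρ : Representation ℂ N W} (h : ρ.IsIrreducible) :
    ρ.IsPRational p where
  irreducible := h
  exists_subgroup := ⟨⊤, hN.to_subgroup ⊤, by simpa using hp, fun n =>
    Algebra.subset_adjoin ⟨n, Subgroup.mem_top n, rfl⟩⟩
  det_pow n := by
    obtain ⟨a, ha⟩ := hN n
    exact ⟨a, by rw [← map_pow, ← map_pow, ha, map_one, map_one]⟩

end Representation

/-- Let `p` be a prime, `G` a finite `p`-solvable group, `N` a minimal normal
subgroup of `G` that is a `p`-group and `l` an irreducible character of `N`.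
Then some `Q_p`-valued irreducible character `χ` of `G` restricts to `N` with
`l` as a constituent (nonzero inner product of `χ|_N` with `l`). -/
theorem exists_Qp_valued_constituent (p : ℕ) (hp : p.Prime)
    (G : Type) [Group G] [Fintype G] (hG : IsPSolvable p G)
    (N : Subgroup G) [N.Normal]
    (hNbot : N ≠ ⊥)
    (hNmin : ∀ M : Subgroup G, M.Normal → M ≤ N → M = ⊥ ∨ M = N)
    (hNp : IsPGroup p N)
    (l : N → ℂ) (hl : IsIrreducibleCharacter N l) :
    ∃ χ : G → ℂ, IsIrreducibleCharacter G χ ∧ (∀ g, χ g ∈ Qfield p) ∧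
      (∑ᶠ x : N, χ (x : G) * star (l x)) ≠ 0 := by
  have : Fact p.Prime := ⟨hp⟩
  obtain ⟨W, hW, rfl⟩ := hl
  have hρ : Representation.IsPRational p W.ρ :=
    (Representation.isIrreducible_of_simple W hW).isPRational hNp hp.ne_one
  obtain ⟨V, _, _, _, σ, hσ, hmem, f, hf0, hf⟩ :=
    hρ.exists_trace_mem (NormalEmbedding.ofNormal N) hG rfl
  refine ⟨σ.character, hσ.isIrreducibleCharacter, hmem, ?_⟩
  rw [finsum_eq_sum_of_fintype]
  exact Representation.sum_character_mul_star_ne_zero (σ := σ.comp N.subtype) (ρ := W.ρ) hf0 hf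
end
end
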